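/- arXiv:1603.05593 — 10 statements merged into one kernel-verified Lean document; each statement's English description precedes it below -/
import Mathlib

section
/- Let R be a commutative ring and n, N natural numbers. Let Λ be an R⟦t⟧-submodule of the free module R⟦t⟧^n such that t^N · R⟦t⟧^n ⊆ Λ, and assume that Λ is finitely generated and projective as an R⟦t⟧-module. Then the quotient R-module R⟦t⟧^n / Λ is projective as an R-module. -/
namespace PowerSeries

variable {R : Type*} [CommRing R]

/-- The `R`-linear map `∑ aₖ tᵏ ↦ ∑ aₖ₊N tᵏ`, a left inverse of multiplication by `t ^ N`. -/
noncomputable def shiftDown (N : ℕ) : PowerSeries R →ₗ[R] PowerSeries R where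
  toFun f := mk fun k => coeff (k + N) f
  map_add' f g := by ext; simp
  map_smul' c f := by ext; simp

theorem coeff_shiftDown (N k : ℕ) (f : PowerSeries R) :
    coeff k (shiftDown N f) = coeff (k + N) f :=
  coeff_mk k fun k => coeff (k + N) f

theorem shiftDown_X_pow_mul (N : ℕ) (f : PowerSeries R) : shiftDown N (X ^ N * f) = f := by
  ext k
  rw [coeff_shiftDown, coeff_X_pow_mul]

/-- The first `N` coefficients of a power series. -/
noncomputable def lowCoeffs (N : ℕ) : PowerSeries R →ₗ[R] (Fin N → R) :=
  LinearMap.pi fun j => coeff (j : ℕ)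

/-- The power series of degree less than `N` with prescribed coefficients. -/
noncomputable def ofLowCoeffs (N : ℕ) : (Fin N → R) →ₗ[R] PowerSeries R where
  toFun c := mk fun k => if h : k < N then c ⟨k, h⟩ else 0
  map_add' c d := by ext k; by_cases h : k < N <;> simp [h]
  map_smul' a c := by ext k; by_cases h : k < N <;> simp [h]

theorem ofLowCoeffs_lowCoeffs_add (N : ℕ) (f : PowerSeries R) :
    ofLowCoeffs N (lowCoeffs N f) + X ^ N * shiftDown N f = f := by
  ext k
  by_cases h : k < N
  · simp [ofLowCoeffs, lowCoeffs, coeff_X_pow_mul', h]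
  · simp [ofLowCoeffs, lowCoeffs, coeff_X_pow_mul', h, coeff_shiftDown,
      Nat.sub_add_cancel (not_lt.mp h)]

/-- A projective `R⟦t⟧`-submodule containing `t ^ N • M` is an `R`-linear direct summand of `M`. -/
theorem exists_retraction_of_X_pow_smul_mem {M : Type*} [AddCommGroup M]
    [Module (PowerSeries R) M] [Module R M] [IsScalarTower R (PowerSeries R) M] (N : ℕ)
    (Λ : Submodule (PowerSeries R) M) [Module.Projective (PowerSeries R) Λ]
    (hN : ∀ v : M, (X : PowerSeries R) ^ N • v ∈ Λ) :
    ∃ r : M →ₗ[R] Λ, ∀ v : Λ, r v = v := by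
  obtain ⟨i, hi⟩ := Module.Projective.out (R := PowerSeries R) (P := Λ)
  let p : (Λ →₀ PowerSeries R) →ₗ[PowerSeries R] Λ := Finsupp.linearCombination _ id
  let m : M →ₗ[PowerSeries R] Λ := (LinearMap.lsmul (PowerSeries R) M (X ^ N)).codRestrict Λ hN
  refine ⟨p.restrictScalars R ∘ₗ Finsupp.mapRange.linearMap (shiftDown N) ∘ₗ
    (i ∘ₗ m).restrictScalars R, fun v => ?_⟩
  have hm : m v = (X : PowerSeries R) ^ N • v := rfl
  have hshift : Finsupp.mapRange.linearMap (shiftDown N) (i (m v)) = i v := by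
    ext1 x
    simp [hm, shiftDown_X_pow_mul]
  change p (Finsupp.mapRange.linearMap (shiftDown N) (i (m v))) = v
  rw [hshift]
  exact hi v

end PowerSeries

/-- Let `R` be a commutative ring and `n N : ℕ`. Let `Λ` be an
`R⟦t⟧`-submodule of `R⟦t⟧ⁿ` with `t^N • R⟦t⟧ⁿ ⊆ Λ`, finitely generated and projective
as an `R⟦t⟧`-module.  Then `R⟦t⟧ⁿ / Λ` is projective as an `R`-module. -/
theorem stmt0 (R : Type*) [CommRing R] (n N : ℕ)
    (Λ : Submodule (PowerSeries R) (Fin n → PowerSeries R))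
    (hN : ∀ v : Fin n → PowerSeries R, ((PowerSeries.X : PowerSeries R) ^ N) • v ∈ Λ)
    (hfg : Λ.FG) (hproj : Module.Projective (PowerSeries R) Λ) :
    Module.Projective R ((Fin n → PowerSeries R) ⧸ Λ) := by
  obtain ⟨r, hr⟩ := PowerSeries.exists_retraction_of_X_pow_smul_mem N Λ hN
  let incl : Λ →ₗ[R] (Fin n → PowerSeries R) := Λ.subtype.restrictScalars R
  let s : ((Fin n → PowerSeries R) ⧸ Λ) →ₗ[R] (Fin n → PowerSeries R) :=
    (Λ.restrictScalars R).liftQ (LinearMap.id - incl ∘ₗ r) fun v hv => by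
      have := hr ⟨v, hv⟩
      simp_all [incl]
  let q : (Fin n → PowerSeries R) →ₗ[R] ((Fin n → PowerSeries R) ⧸ Λ) :=
    Λ.mkQ.restrictScalars R
  have hq : ∀ v, q ((PowerSeries.ofLowCoeffs N).compLeft (Fin n)
      ((PowerSeries.lowCoeffs N).compLeft (Fin n) v)) = q v := fun v => by
    refine ((Submodule.Quotient.eq Λ).mpr ?_).symm
    convert hN ((PowerSeries.shiftDown N).compLeft (Fin n) v) using 1
    ext1 j
    exact sub_eq_of_eq_add' (PowerSeries.ofLowCoeffs_lowCoeffs_add N (v j)).symm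
  refine Module.Projective.of_split ((PowerSeries.lowCoeffs N).compLeft (Fin n) ∘ₗ s)
    (q ∘ₗ (PowerSeries.ofLowCoeffs N).compLeft (Fin n)) (LinearMap.ext fun x => ?_)
  obtain ⟨v, rfl⟩ := Submodule.Quotient.mk_surjective Λ x
  refine (hq (s (Submodule.Quotient.mk v))).trans ((Submodule.Quotient.eq Λ).mpr ?_)
  change v - (r v : Fin n → PowerSeries R) - v ∈ Λ
  simp
end

section
/- Let R be a commutative ring and n, N natural numbers. Let Λ be an R⟦t⟧-submodule of the free module R⟦t⟧^n such that t^N · R⟦t⟧^n ⊆ Λ, and assume that the quotient R-module R⟦t⟧^n / Λ is projective as an R-module. Then Λ is a finitely generated projective R⟦t⟧-module. -/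
open PowerSeries TensorProduct

/-- **Schanuel's lemma**, retract form: if `f : F → M` and `g : P → M` are surjections from
projective modules, then `ker f` is finite projective as soon as `F` and `ker g` are. -/
theorem finite_projective_ker_of_surjective {A F P M : Type*} [CommRing A]
    [AddCommGroup F] [Module A F] [AddCommGroup P] [Module A P] [AddCommGroup M] [Module A M]
    [Module.Finite A F] [Module.Projective A F] [Module.Projective A P]
    (f : F →ₗ[A] M) (g : P →ₗ[A] M)
    (hf : Function.Surjective f) (hg : Function.Surjective g)
    [Module.Finite A (LinearMap.ker g)] [Module.Projective A (LinearMap.ker g)] :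
    Module.Finite A (LinearMap.ker f) ∧ Module.Projective A (LinearMap.ker f) := by
  obtain ⟨h, hh⟩ := Module.projective_lifting_property f g hf
  obtain ⟨k, hk⟩ := Module.projective_lifting_property g f hg
  have hh' (y : P) : f (h y) = g y := LinearMap.congr_fun hh y
  have hk' (x : F) : g (k x) = f x := LinearMap.congr_fun hk x
  let i : LinearMap.ker f →ₗ[A] F × LinearMap.ker g :=
    (LinearMap.ker f).subtype.prod
      ((k ∘ₗ (LinearMap.ker f).subtype).codRestrict (LinearMap.ker g) fun x => by simp [hk'])
  let s : F × LinearMap.ker g →ₗ[A] LinearMap.ker f :=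
    (LinearMap.coprod (LinearMap.id - h ∘ₗ k) (h ∘ₗ (LinearMap.ker g).subtype)).codRestrict
      (LinearMap.ker f) fun x => by simp [hh', hk']
  have hs : s ∘ₗ i = LinearMap.id := by
    refine LinearMap.ext fun x => Subtype.ext ?_
    change (x : F) - h (k x) + h (k x) = x
    exact sub_add_cancel _ _
  exact ⟨Module.Finite.of_surjective s fun x => ⟨i x, LinearMap.congr_fun hs x⟩,
    Module.Projective.of_split i s hs⟩

section

variable {R M : Type*} [CommRing R] [AddCommGroup M] [Module R M] [Module R⟦X⟧ M]
  [IsScalarTower R R⟦X⟧ M]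

variable (R M) in
/-- The action of `X` on an `R⟦X⟧`-module, as an `R`-linear endomorphism. -/
noncomputable def PowerSeries.mulX : Module.End R M :=
  ((X : R⟦X⟧) • (LinearMap.id : M →ₗ[R⟦X⟧] M)).restrictScalars R

theorem PowerSeries.mulX_apply (m : M) : mulX R M m = (X : R⟦X⟧) • m := rfl

theorem PowerSeries.mulX_pow_apply (k : ℕ) (m : M) : (mulX R M ^ k) m = (X : R⟦X⟧) ^ k • m := by
  induction k with
  | zero => simp
  | succ k ih => rw [pow_succ', Module.End.mul_apply, ih, mulX_apply, pow_succ', mul_smul]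

variable (R M) in
/-- The endomorphism `X ⊗ 1 - 1 ⊗ X` of `R⟦X⟧ ⊗[R] M`. -/
noncomputable def PowerSeries.tensorDiffX : R⟦X⟧ ⊗[R] M →ₗ[R⟦X⟧] R⟦X⟧ ⊗[R] M :=
  (X : R⟦X⟧) • LinearMap.id - (mulX R M).baseChange R⟦X⟧

theorem PowerSeries.tensorDiffX_tmul (a : R⟦X⟧) (m : M) :
    tensorDiffX R M (a ⊗ₜ m) = (X * a) ⊗ₜ m - a ⊗ₜ[R] ((X : R⟦X⟧) • m) := by
  simp [tensorDiffX, mulX_apply, smul_tmul']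

theorem PowerSeries.tensorDiffX_injective [Module.Flat R M] (N : ℕ)
    (hM : ∀ m : M, (X : R⟦X⟧) ^ N • m = 0) : Function.Injective (tensorDiffX R M) := by
  rw [injective_iff_map_eq_zero]
  intro z hz
  have hXz : (X : R⟦X⟧) • z = (mulX R M).baseChange R⟦X⟧ z := by
    simpa [tensorDiffX, sub_eq_zero] using hz
  have hpow (k : ℕ) : (X : R⟦X⟧) ^ k • z = ((mulX R M).baseChange R⟦X⟧ ^ k) z := by
    induction k with
    | zero => simp
    | succ k ih => rw [pow_succ, mul_smul, hXz, ← map_smul, ih, pow_succ', Module.End.mul_apply]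
  have hzero : mulX R M ^ N = 0 := by
    ext m
    rw [mulX_pow_apply, hM, LinearMap.zero_apply]
  have hreg : IsRegular ((X : R⟦X⟧) ^ N) := by
    rw [← isLeftRegular_iff_isRegular]
    exact fun _ _ => X_pow_mul_cancel
  apply Module.Flat.isSMulRegular_of_isRegular (M := R⟦X⟧ ⊗[R] M) hreg
  simp only [smul_zero]
  rw [hpow, ← LinearMap.baseChange_pow, hzero, LinearMap.baseChange_zero, LinearMap.zero_apply]

theorem PowerSeries.tmul_sub_one_tmul_smul_mem_range (k : ℕ) (a : R⟦X⟧) (m : M)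
    (hm : (X : R⟦X⟧) ^ k • m = 0) :
    a ⊗ₜ[R] m - 1 ⊗ₜ[R] (a • m) ∈ LinearMap.range (tensorDiffX R M) := by
  induction k generalizing a m with
  | zero =>
    obtain rfl : m = 0 := by simpa using hm
    simp
  | succ k ih =>
    obtain ⟨b, r, rfl⟩ : ∃ (b : R⟦X⟧) (r : R), a = X * b + C r :=
      ⟨_, _, eq_X_mul_shift_add_const a⟩
    have hC : (C r : R⟦X⟧) ⊗ₜ[R] m = 1 ⊗ₜ[R] ((C r : R⟦X⟧) • m) := by
      rw [← algebraMap_eq, algebraMap_smul, Algebra.algebraMap_eq_smul_one, smul_tmul]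
    have hX := ih b ((X : R⟦X⟧) • m) (by rw [← mul_smul, ← pow_succ, hm])
    have key : (X * b + C r) ⊗ₜ[R] m - 1 ⊗ₜ[R] ((X * b + C r) • m) =
        tensorDiffX R M (b ⊗ₜ m) +
          (b ⊗ₜ[R] ((X : R⟦X⟧) • m) - 1 ⊗ₜ[R] (b • (X : R⟦X⟧) • m)) := by
      rw [tensorDiffX_tmul, add_tmul, add_smul, tmul_add, hC, mul_comm X b, mul_smul]
      abel
    rw [key]
    exact add_mem (LinearMap.mem_range_self _ _) hX

/-- The sequence `R⟦X⟧ ⊗[R] M → R⟦X⟧ ⊗[R] M → M` is exact when `X` acts nilpotently on `M`. -/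
theorem PowerSeries.ker_liftBaseChange_id_eq_range (N : ℕ)
    (hM : ∀ m : M, (X : R⟦X⟧) ^ N • m = 0) :
    LinearMap.ker ((LinearMap.id : M →ₗ[R] M).liftBaseChange R⟦X⟧) =
      LinearMap.range (tensorDiffX R M) := by
  apply le_antisymm
  · intro z hz
    have hsub : z - 1 ⊗ₜ[R] ((LinearMap.id : M →ₗ[R] M).liftBaseChange R⟦X⟧ z) ∈
        LinearMap.range (tensorDiffX R M) := by
      clear hz
      induction z with
      | zero => simp
      | tmul a m => simpa using tmul_sub_one_tmul_smul_mem_range N a m (hM m)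
      | add x y hx hy =>
        rw [map_add, tmul_add, add_sub_add_comm]
        exact add_mem hx hy
    rwa [LinearMap.mem_ker.mp hz, tmul_zero, sub_zero] at hsub
  · rw [LinearMap.range_le_ker_iff]
    ext m
    simp [tensorDiffX_tmul]

/-- A finite `R⟦X⟧`-module killed by a power of `X` is finite over `R`. -/
theorem PowerSeries.finite_of_X_pow_smul_eq_zero [Module.Finite R⟦X⟧ M] (N : ℕ)
    (hM : ∀ m : M, (X : R⟦X⟧) ^ N • m = 0) : Module.Finite R M := by
  obtain ⟨n, f, hf⟩ := Module.Finite.exists_fin' R⟦X⟧ M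
  let φ : (Fin n → Polynomial.degreeLT R N) →ₗ[R] M :=
    f.restrictScalars R ∘ₗ LinearMap.compLeft
      ((Polynomial.coeToPowerSeries.algHom R).toLinearMap ∘ₗ (Polynomial.degreeLT R N).subtype)
      (Fin n)
  have : Module.Finite R (Polynomial.degreeLT R N) :=
    Module.Finite.equiv (Polynomial.degreeLTEquiv R N).symm
  refine Module.Finite.of_surjective φ fun m => ?_
  obtain ⟨v, rfl⟩ := hf m
  refine ⟨fun i => ⟨trunc N (v i), Polynomial.mem_degreeLT.mpr (degree_trunc_lt _ _)⟩, ?_⟩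
  have hv : v = (X : R⟦X⟧) ^ N • (fun i => PowerSeries.mk fun j => coeff (j + N) (v i)) +
      fun i => (trunc N (v i) : R⟦X⟧) := by
    funext i
    exact eq_X_pow_mul_shift_add_trunc N (v i)
  conv_rhs => rw [hv, map_add, map_smul, hM, zero_add]
  simp only [φ, LinearMap.comp_apply, LinearMap.restrictScalars_apply]
  congr 1

end

/-- Let `R` be a commutative ring and `n N : ℕ`. Let `Λ` be an
`R⟦t⟧`-submodule of `R⟦t⟧ⁿ` with `t^N • R⟦t⟧ⁿ ⊆ Λ`, and assume the quotient
`R⟦t⟧ⁿ / Λ` is projective as an `R`-module.  Then `Λ` is a finitely generated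
projective `R⟦t⟧`-module. -/
theorem stmt1 (R : Type*) [CommRing R] (n N : ℕ)
    (Λ : Submodule (PowerSeries R) (Fin n → PowerSeries R))
    (hN : ∀ v : Fin n → PowerSeries R, ((PowerSeries.X : PowerSeries R) ^ N) • v ∈ Λ)
    (hquot : Module.Projective R ((Fin n → PowerSeries R) ⧸ Λ)) :
    Λ.FG ∧ Module.Projective (PowerSeries R) Λ := by
  have hM (m : (Fin n → R⟦X⟧) ⧸ Λ) : (X : R⟦X⟧) ^ N • m = 0 := by
    obtain ⟨v, rfl⟩ := Λ.mkQ_surjective m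
    rw [← map_smul, Submodule.mkQ_apply, Submodule.Quotient.mk_eq_zero]
    exact hN v
  have : Module.Finite R ((Fin n → R⟦X⟧) ⧸ Λ) := finite_of_X_pow_smul_eq_zero N hM
  let g := (LinearMap.id : ((Fin n → R⟦X⟧) ⧸ Λ) →ₗ[R] _).liftBaseChange R⟦X⟧
  have hg : Function.Surjective g := fun m => ⟨1 ⊗ₜ m, by simp [g]⟩
  let e : (R⟦X⟧ ⊗[R] ((Fin n → R⟦X⟧) ⧸ Λ)) ≃ₗ[R⟦X⟧] LinearMap.ker g :=
    (LinearEquiv.ofInjective _ (tensorDiffX_injective N hM)).trans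
      (LinearEquiv.ofEq _ _ (ker_liftBaseChange_id_eq_range N hM).symm)
  have : Module.Finite R⟦X⟧ (LinearMap.ker g) := Module.Finite.equiv e
  have : Module.Projective R⟦X⟧ (LinearMap.ker g) := Module.Projective.of_equiv e
  have key := finite_projective_ker_of_surjective Λ.mkQ g Λ.mkQ_surjective hg
  rw [Submodule.ker_mkQ] at key
  exact ⟨Module.Finite.iff_fg.mp key.1, key.2⟩
end

section
/- Let R be a commutative ring, n ≥ 1, and let Λ be an R⟦t⟧-submodule of R((t))^n which is finitely generated and projective as an R⟦t⟧-module and which spans R((t))^n as an R((t))-module (i.e. the R((t))-linear span of Λ is all of R((t))^n). Then there exists a natural number N such that t^N · Λ₀ ⊆ Λ and t^N · Λ ⊆ Λ₀, where Λ₀ ⊆ R((t))^n denotes the standard lattice R⟦t⟧^n (the R⟦t⟧-submodule generated by the standard basis vectors). In other words, t^N R⟦t⟧^n ⊆ Λ ⊆ t^{-N} R⟦t⟧^n. -/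
open PowerSeries

/-- If `P` is a finitely generated `A`-submodule of a module over `S = A[1/x]` and `Q` is an
`A`-submodule spanning the whole module over `S`, then some power of `x` carries `P` into `Q`. -/
theorem Submodule.FG.exists_pow_smul_mem_of_localization_span_eq_top {A S M : Type*} [CommRing A]
    [CommRing S] [Algebra A S] [AddCommGroup M] [Module A M] [Module S M] [IsScalarTower A S M]
    (x : A) [IsLocalization (Submonoid.powers x) S] {P Q : Submodule A M} (hP : P.FG)
    (hQ : Submodule.span S (Q : Set M) = ⊤) :
    ∃ N : ℕ, ∀ m, N ≤ m → ∀ v ∈ P, x ^ m • v ∈ Q := by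
  induction P, hP using Submodule.fg_induction with
  | singleton v =>
    obtain ⟨⟨_, N, rfl⟩, hN⟩ := multiple_mem_span_of_mem_localization_span
      (Submonoid.powers x) S (Q : Set M) v (hQ ▸ Submodule.mem_top)
    rw [Submodule.span_eq] at hN
    refine ⟨N, fun m hm w hw ↦ ?_⟩
    obtain ⟨a, rfl⟩ := Submodule.mem_span_singleton.1 hw
    obtain ⟨k, rfl⟩ := Nat.exists_eq_add_of_le' hm
    rw [smul_comm, pow_add, mul_smul]
    exact Q.smul_mem _ (Q.smul_mem _ hN)
  | sup P₁ P₂ _ _ h₁ h₂ =>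
    obtain ⟨N₁, h₁⟩ := h₁
    obtain ⟨N₂, h₂⟩ := h₂
    refine ⟨max N₁ N₂, fun m hm v hv ↦ ?_⟩
    obtain ⟨y, hy, z, hz, rfl⟩ := Submodule.mem_sup.1 hv
    rw [smul_add]
    exact Q.add_mem (h₁ m (le_of_max_le_left hm) y hy) (h₂ m (le_of_max_le_right hm) z hz)

/-- Let `R` be a commutative ring, `n ≥ 1`, and `Λ` an `R⟦t⟧`-submodule of
`R((t))ⁿ` which is finitely generated and projective over `R⟦t⟧` and whose `R((t))`-linear
span is all of `R((t))ⁿ`.  Then there is `N : ℕ` with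
`t^N · Λ₀ ⊆ Λ` and `t^N · Λ ⊆ Λ₀`, where `Λ₀ = R⟦t⟧ⁿ` is the standard lattice
(the `R⟦t⟧`-submodule generated by the standard basis vectors). -/
theorem stmt2 (R : Type*) [CommRing R] (n : ℕ) (hn : 1 ≤ n)
    (Λ : Submodule (PowerSeries R) (Fin n → LaurentSeries R))
    (hfg : Λ.FG) (hproj : Module.Projective (PowerSeries R) Λ)
    (hspan : Submodule.span (LaurentSeries R) (Λ : Set (Fin n → LaurentSeries R)) = ⊤) :
    ∃ N : ℕ,
      (∀ v ∈ Submodule.span (PowerSeries R)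
          (Set.range fun i : Fin n => (Pi.single i 1 : Fin n → LaurentSeries R)),
        ((PowerSeries.X : PowerSeries R) ^ N) • v ∈ Λ) ∧
      (∀ v ∈ Λ, ((PowerSeries.X : PowerSeries R) ^ N) • v ∈
        Submodule.span (PowerSeries R)
          (Set.range fun i : Fin n => (Pi.single i 1 : Fin n → LaurentSeries R))) := by
  have hstd : Submodule.span (LaurentSeries R) (Submodule.span (PowerSeries R)
      (Set.range fun i : Fin n => (Pi.single i 1 : Fin n → LaurentSeries R)) :
        Set (Fin n → LaurentSeries R)) = ⊤ := by
    rw [Submodule.span_span_of_tower, ← (Pi.basisFun (LaurentSeries R) (Fin n)).span_eq]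
    congr 2
    ext1 i
    rw [Pi.basisFun_apply]
  obtain ⟨N₁, h₁⟩ := Submodule.FG.exists_pow_smul_mem_of_localization_span_eq_top
    (S := LaurentSeries R) (PowerSeries.X : PowerSeries R)
    (Submodule.fg_span (Set.finite_range
      fun i : Fin n => (Pi.single i 1 : Fin n → LaurentSeries R))) hspan
  obtain ⟨N₂, h₂⟩ := Submodule.FG.exists_pow_smul_mem_of_localization_span_eq_top
    (S := LaurentSeries R) (PowerSeries.X : PowerSeries R) hfg hstd
  exact ⟨max N₁ N₂, h₁ _ (le_max_left _ _), h₂ _ (le_max_right _ _)⟩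
end

section
/- Let A and Ã be commutative rings and p : A → Ã a ring homomorphism. Let f ∈ A be such that f is not a zero divisor in A and p(f) is not a zero divisor in Ã, and such that the induced ring homomorphism A/fA → Ã/p(f)Ã is an isomorphism. If M is an A-module on which multiplication by f is injective (M is f-torsion-free), then multiplication by p(f) is injective on the Ã-module Ã ⊗_A M; that is, the base change functor M ↦ Ã ⊗_A M carries f-torsion-free A-modules to p(f)-torsion-free Ã-modules. -/
open scoped TensorProduct

/-- The sequence `A → A × B → B` given by `a ↦ (f a, -a)` and `(a, b) ↦ a + f b` is exact at the
middle term when `A/fA → B/fB` is injective and `f` is a nonzerodivisor on `B`. -/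
theorem exact_smul_prod_neg_coprod_smul {A B : Type*} [CommRing A] [CommRing B] [Algebra A B]
    (f : A) (hpf : algebraMap A B f ∈ nonZeroDivisors B)
    (hinj : ∀ a : A, algebraMap A B f ∣ algebraMap A B a → f ∣ a) :
    Function.Exact ((f • LinearMap.id : A →ₗ[A] A).prod (-Algebra.linearMap A B))
      ((Algebra.linearMap A B).coprod (f • LinearMap.id : B →ₗ[A] B)) := by
  rintro ⟨a, b⟩
  change algebraMap A B a + f • b = 0 ↔ ∃ c : A, (f * c, -algebraMap A B c) = (a, b)
  simp only [Algebra.smul_def, Prod.mk.injEq]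
  constructor
  · intro h
    obtain ⟨c, rfl⟩ := hinj a ⟨-b, by linear_combination h⟩
    refine ⟨c, rfl, ?_⟩
    rw [map_mul, ← mul_add] at h
    have := (mul_left_mem_nonZeroDivisors_eq_zero_iff hpf).mp h
    linear_combination -this
  · rintro ⟨c, rfl, rfl⟩
    rw [map_mul]
    ring

/-- Beauville–Laszlo, part (1).  Let `p : A → B` be a homomorphism of
commutative rings, `f ∈ A` a nonzerodivisor with `p f` a nonzerodivisor in `B`, such that the
induced map `A/fA → B/(p f)B` is an isomorphism.  If `M` is an `f`-torsion-free `A`-module,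
then `B ⊗[A] M` is `p f`-torsion-free. -/
theorem stmt3 {A B : Type*} [CommRing A] [CommRing B] [Algebra A B] (f : A)
    (hf : f ∈ nonZeroDivisors A) (hpf : algebraMap A B f ∈ nonZeroDivisors B)
    (hiso : Function.Bijective
      (Ideal.quotientMap (Ideal.span {algebraMap A B f}) (algebraMap A B)
        ((Ideal.span_singleton_le_iff_mem _).mpr
          (Ideal.mem_comap.mpr (Ideal.mem_span_singleton_self _)))))
    (M : Type*) [AddCommGroup M] [Module A M]
    (hM : Function.Injective fun m : M => f • m) :
    Function.Injective fun x : B ⊗[A] M => algebraMap A B f • x := by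
  have hinj (a : A) (ha : algebraMap A B f ∣ algebraMap A B a) : f ∣ a := by
    rw [← Ideal.mem_span_singleton, ← Ideal.Quotient.eq_zero_iff_mem]
    apply hiso.1
    rw [map_zero, Ideal.quotientMap_mk, Ideal.Quotient.eq_zero_iff_mem]
    exact Ideal.mem_span_singleton.mpr ha
  have hsurj : Function.Surjective
      ((Algebra.linearMap A B).coprod (f • LinearMap.id : B →ₗ[A] B)) := by
    intro b
    obtain ⟨q, hq⟩ := hiso.2 (Ideal.Quotient.mk _ b)
    obtain ⟨a, rfl⟩ := Ideal.Quotient.mk_surjective q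
    rw [Ideal.quotientMap_mk, eq_comm, Ideal.Quotient.eq, Ideal.mem_span_singleton] at hq
    obtain ⟨c, hc⟩ := hq
    refine ⟨(a, c), ?_⟩
    change algebraMap A B a + f • c = b
    rw [Algebra.smul_def]
    linear_combination -hc
  have hexact := rTensor_exact M (exact_smul_prod_neg_coprod_smul f hpf hinj) hsurj
  change Function.Injective (LinearMap.lsmul B (B ⊗[A] M) (algebraMap A B f))
  rw [injective_iff_map_eq_zero]
  intro x hx
  rw [LinearMap.lsmul_apply, algebraMap_smul] at hx
  obtain ⟨y, hy⟩ := (hexact ((LinearMap.inr A A B).rTensor M x)).mp (by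
    rw [← LinearMap.rTensor_comp_apply, LinearMap.coprod_inr, LinearMap.rTensor_smul,
      LinearMap.rTensor_id]
    exact hx)
  have hfst := congrArg ((LinearMap.fst A A B).rTensor M) hy
  rw [← LinearMap.rTensor_comp_apply, ← LinearMap.rTensor_comp_apply, LinearMap.fst_prod,
    LinearMap.fst_comp_inr, LinearMap.rTensor_zero, LinearMap.rTensor_smul,
    LinearMap.rTensor_id] at hfst
  have hy0 : y = 0 := by
    apply (TensorProduct.lid A M).injective
    apply hM
    simpa using congrArg (TensorProduct.lid A M) hfst
  have hsnd := congrArg ((LinearMap.snd A A B).rTensor M) hy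
  rw [hy0, map_zero, map_zero, ← LinearMap.rTensor_comp_apply, LinearMap.snd_comp_inr,
    LinearMap.rTensor_id] at hsnd
  exact hsnd.symm
end

section
/- Let A and Ã be commutative rings and p : A → Ã a ring homomorphism. Let f ∈ A be such that f is not a zero divisor in A and p(f) is not a zero divisor in Ã, and such that the induced ring homomorphism A/fA → Ã/p(f)Ã is an isomorphism. Let M be an f-torsion-free A-module. Then M is the fiber product of its localizations: for every pair consisting of an element x of the localization M_f = A_f ⊗_A M and an element y of Ã ⊗_A M whose images in Ã_{p(f)} ⊗_A M coincide (under the canonical maps M_f → Ã_{p(f)} ⊗_A M and Ã ⊗_A M → Ã_{p(f)} ⊗_A M), there exists a unique m ∈ M whose canonical images in M_f and in Ã ⊗_A M are x and y respectively. Equivalently, the sequence 0 → M → M_f ⊕ (Ã ⊗_A M) → Ã_{p(f)} ⊗_A M is exact, the last map being the difference of the two canonical maps. -/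
open scoped TensorProduct

/-- The canonical `A`-algebra homomorphism `A_f → B_{p f}` induced by `p : A → B`, where
`A_f` is a localization of `A` away from `f` and `B_{p f}` a localization of `B` away
from `p f`. -/
noncomputable def awayMapAlgHom (A B : Type*) [CommRing A] [CommRing B] [Algebra A B]
    (f : A) (Af Bf : Type*) [CommRing Af] [Algebra A Af] [IsLocalization.Away f Af]
    [CommRing Bf] [Algebra B Bf] [Algebra A Bf] [IsScalarTower A B Bf]
    [IsLocalization.Away (algebraMap A B f) Bf] : Af →ₐ[A] Bf :=
  { IsLocalization.map (M := Submonoid.powers f)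
      (T := Submonoid.powers (algebraMap A B f)) Bf (algebraMap A B)
      (by rintro a ⟨m, rfl⟩; exact ⟨m, (map_pow _ _ _).symm⟩) with
    commutes' := fun a => by
      simpa [IsScalarTower.algebraMap_apply A B Bf] using
        IsLocalization.map_eq (S := Af) (Q := Bf)
          (g := algebraMap A B)
          (by rintro a ⟨m, rfl⟩; exact ⟨m, (map_pow _ _ _).symm⟩ :
            Submonoid.powers f ≤ (Submonoid.powers (algebraMap A B f)).comap (algebraMap A B)) a }

/-- Multiplication by `f` is surjective on the cokernel of `A → B` tensored with any module. -/
theorem exists_one_tmul_add_smul {A B : Type*} [CommRing A] [CommRing B] [Algebra A B] (f : A)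
    (hsurj : ∀ b : B, ∃ (a : A) (b' : B), b = algebraMap A B a + f • b')
    {M : Type*} [AddCommGroup M] [Module A M] (y : B ⊗[A] M) :
    ∃ (m : M) (z : B ⊗[A] M), y = 1 ⊗ₜ m + f • z := by
  induction y with
  | zero => exact ⟨0, 0, by simp⟩
  | tmul b m =>
    obtain ⟨a, b', rfl⟩ := hsurj b
    refine ⟨a • m, b' ⊗ₜ m, ?_⟩
    rw [TensorProduct.add_tmul, Algebra.algebraMap_eq_smul_one, TensorProduct.smul_tmul,
      TensorProduct.smul_tmul']
  | add y₁ y₂ h₁ h₂ =>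
    obtain ⟨m₁, z₁, rfl⟩ := h₁
    obtain ⟨m₂, z₂, rfl⟩ := h₂
    refine ⟨m₁ + m₂, z₁ + z₂, ?_⟩
    rw [TensorProduct.tmul_add, smul_add]
    abel

/-- If `e : B → A/fA` is an `A`-linear map with `e 1 = 1`, then `M/fM → (B ⊗ M)/f(B ⊗ M)` is
injective. -/
theorem exists_eq_smul_of_one_tmul_eq_smul {A B : Type*} [CommRing A] [CommRing B] [Algebra A B]
    (f : A) (e : B →ₗ[A] A ⧸ Ideal.span {f}) (he : e 1 = 1)
    {M : Type*} [AddCommGroup M] [Module A M] {m : M} {z : B ⊗[A] M}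
    (h : (1 : B) ⊗ₜ[A] m = f • z) : ∃ m' : M, m = f • m' := by
  have h₁ := congrArg (fun t => e.rTensor M t) h
  have h₂ : f • e.rTensor M z = 0 := by
    generalize e.rTensor M z = w
    induction w with
    | zero => simp
    | tmul b m =>
      have hb : f • b = 0 := by
        obtain ⟨a, rfl⟩ := Ideal.Quotient.mk_surjective b
        rw [Algebra.smul_def, Ideal.Quotient.algebraMap_eq, ← map_mul,
          Ideal.Quotient.eq_zero_iff_mem]
        exact Ideal.mul_mem_right _ _ (Ideal.mem_span_singleton_self f)
      rw [TensorProduct.smul_tmul', hb, TensorProduct.zero_tmul]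
    | add y₁ y₂ h₁ h₂ => rw [smul_add, h₁, h₂, add_zero]
  simp only [map_smul, h₂, LinearMap.rTensor_tmul, he] at h₁
  have h₃ := congrArg (TensorProduct.quotTensorEquivQuotSMul M (Ideal.span {f})) h₁
  rw [← map_one (Ideal.Quotient.mk (Ideal.span {f})),
    TensorProduct.quotTensorEquivQuotSMul_mk_tmul, map_zero, one_smul,
    Submodule.Quotient.mk_eq_zero, Submodule.ideal_span_singleton_smul] at h₃
  obtain ⟨m', -, rfl⟩ := h₃
  exact ⟨m', rfl⟩

/-- An isomorphism `A/fA ≅ B/fB` provides an `A`-linear map `B → A/fA` sending `1` to `1`. -/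
theorem exists_linearMap_quotient_of_bijective_quotientMap {A B : Type*} [CommRing A] [CommRing B]
    [Algebra A B] (I : Ideal A) (J : Ideal B) (hIJ : I ≤ J.comap (algebraMap A B))
    (hiso : Function.Bijective (Ideal.quotientMap J (algebraMap A B) hIJ)) :
    ∃ e : B →ₗ[A] A ⧸ I, e 1 = 1 := by
  let g : (A ⧸ I) ≃ₐ[A] (B ⧸ J) := AlgEquiv.ofBijective
    { Ideal.quotientMap J (algebraMap A B) hIJ with commutes' := fun _ => rfl } hiso
  exact ⟨(g.symm.toAlgHom.comp (Ideal.Quotient.mkₐ A J)).toLinearMap, by simp⟩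

/-- If `A/fA ≅ B/fB` and `f` is regular on `B`, then `B ⊗ M` is `f`-torsion-free for every
`f`-torsion-free quotient `M` of a flat module. -/
theorem IsSMulRegular.tensorProduct_of_flat_surjective {A B : Type*} [CommRing A] [CommRing B]
    [Algebra A B] {f : A} (hB : IsSMulRegular B f)
    (hsurj : ∀ b : B, ∃ (a : A) (b' : B), b = algebraMap A B a + f • b')
    (e : B →ₗ[A] A ⧸ Ideal.span {f}) (he : e 1 = 1)
    {M : Type*} [AddCommGroup M] [Module A M] (hM : IsSMulRegular M f)
    {F : Type*} [AddCommGroup F] [Module A F] [Module.Flat A F] (π : F →ₗ[A] M)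
    (hπ : Function.Surjective π) :
    IsSMulRegular (B ⊗[A] M) f := by
  have hF : IsSMulRegular (B ⊗[A] F) f := hB.rTensor _
  have hex : Function.Exact (π.ker.subtype.lTensor B) (π.lTensor B) :=
    lTensor_exact B (LinearMap.exact_subtype_ker_map π) hπ
  refine (isSMulRegular_iff_right_eq_zero_of_smul (R := A) (M := B ⊗[A] M)).mpr ?_
  intro y hy
  obtain ⟨Y, rfl⟩ := LinearMap.lTensor_surjective B hπ y
  rw [← map_smul] at hy
  obtain ⟨W, hW⟩ := (hex _).mp hy
  obtain ⟨r, Z, rfl⟩ := exists_one_tmul_add_smul f hsurj W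
  rw [map_add, map_smul, LinearMap.lTensor_tmul, Submodule.subtype_apply, ← eq_sub_iff_add_eq] at hW
  replace hW := hW.trans (smul_sub f Y (π.ker.subtype.lTensor B Z)).symm
  obtain ⟨ψ, hψ⟩ := exists_eq_smul_of_one_tmul_eq_smul f e he hW
  have hψ_mem : π ψ = 0 := hM.right_eq_zero_of_smul (by rw [← map_smul, ← hψ]; exact r.2)
  rw [hψ, TensorProduct.tmul_smul] at hW
  refine (hex _).mpr ⟨1 ⊗ₜ ⟨ψ, hψ_mem⟩ + Z, ?_⟩
  rw [map_add, LinearMap.lTensor_tmul, Submodule.subtype_apply, hF hW, sub_add_cancel]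

/-- If `A/fA ≅ B/fB` and `f` is regular on `B`, then base change to `B` preserves
`f`-torsion-free modules, even if `B` is not flat. -/
theorem IsSMulRegular.tensorProduct_of_quotient {A B : Type*} [CommRing A] [CommRing B]
    [Algebra A B] {f : A} (hB : IsSMulRegular B f)
    (hsurj : ∀ b : B, ∃ (a : A) (b' : B), b = algebraMap A B a + f • b')
    (e : B →ₗ[A] A ⧸ Ideal.span {f}) (he : e 1 = 1)
    {M : Type*} [AddCommGroup M] [Module A M] (hM : IsSMulRegular M f) :
    IsSMulRegular (B ⊗[A] M) f :=
  hB.tensorProduct_of_flat_surjective hsurj e he hM (Finsupp.linearCombination A id)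
    (Finsupp.linearCombination_id_surjective A M)

/-- If `1 ⊗ m` is divisible by `f ^ n` in an `f`-torsion-free `B ⊗ M`, then the division can be
carried out in `M`. -/
theorem exists_eq_pow_smul_of_one_tmul_eq_pow_smul {A B : Type*} [CommRing A] [CommRing B]
    [Algebra A B] {f : A} (e : B →ₗ[A] A ⧸ Ideal.span {f}) (he : e 1 = 1)
    {M : Type*} [AddCommGroup M] [Module A M] (hBM : IsSMulRegular (B ⊗[A] M) f) (n : ℕ)
    {m : M} {y : B ⊗[A] M} (h : (1 : B) ⊗ₜ[A] m = f ^ n • y) :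
    ∃ m' : M, m = f ^ n • m' ∧ (1 : B) ⊗ₜ[A] m' = y := by
  induction n generalizing m with
  | zero => exact ⟨m, by simpa using h⟩
  | succ n ih =>
    rw [pow_succ', mul_smul] at h
    obtain ⟨m₁, rfl⟩ := exists_eq_smul_of_one_tmul_eq_smul f e he h
    rw [TensorProduct.tmul_smul] at h
    obtain ⟨m', rfl, hm'⟩ := ih (hBM h)
    exact ⟨m', by rw [pow_succ', mul_smul], hm'⟩

/-- Beauville–Laszlo, full faithfulness.  With `p : A → B`, `f` a
nonzerodivisor of `A`, `p f` a nonzerodivisor of `B` and `A/fA ≅ B/(p f)B`, every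
`f`-torsion-free `A`-module `M` is the fiber product of `M_f = A_f ⊗[A] M` and `B ⊗[A] M`
over `B_{p f} ⊗[A] M`: whenever `x : A_f ⊗[A] M` and `y : B ⊗[A] M` have the same image in
`B_{p f} ⊗[A] M`, there is a unique `m : M` mapping to `x` and `y` under the canonical maps. -/
theorem stmt4 {A B : Type*} [CommRing A] [CommRing B] [Algebra A B] (f : A)
    (hf : f ∈ nonZeroDivisors A) (hpf : algebraMap A B f ∈ nonZeroDivisors B)
    (hiso : Function.Bijective
      (Ideal.quotientMap (Ideal.span {algebraMap A B f}) (algebraMap A B)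
        ((Ideal.span_singleton_le_iff_mem _).mpr
          (Ideal.mem_comap.mpr (Ideal.mem_span_singleton_self _)))))
    (Af Bf : Type*) [CommRing Af] [Algebra A Af] [IsLocalization.Away f Af]
    [CommRing Bf] [Algebra B Bf] [Algebra A Bf] [IsScalarTower A B Bf]
    [IsLocalization.Away (algebraMap A B f) Bf]
    (M : Type*) [AddCommGroup M] [Module A M]
    (hM : Function.Injective fun m : M => f • m)
    (x : Af ⊗[A] M) (y : B ⊗[A] M)
    (hxy : LinearMap.rTensor M (awayMapAlgHom A B f Af Bf).toLinearMap x =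
      LinearMap.rTensor M (IsScalarTower.toAlgHom A B Bf).toLinearMap y) :
    ∃! m : M, (1 : Af) ⊗ₜ[A] m = x ∧ (1 : B) ⊗ₜ[A] m = y := by
  have hMreg : IsSMulRegular M f := hM
  have hBreg : IsSMulRegular B f := by
    rw [isSMulRegular_iff_right_eq_zero_of_smul]
    intro b hb
    rw [Algebra.smul_def, mul_comm] at hb
    exact (mem_nonZeroDivisors_iff_right.mp hpf) b hb
  have hsurj : ∀ b : B, ∃ (a : A) (b' : B), b = algebraMap A B a + f • b' := by
    intro b
    obtain ⟨q, hq⟩ := hiso.2 (Ideal.Quotient.mk _ b)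
    obtain ⟨a, rfl⟩ := Ideal.Quotient.mk_surjective q
    rw [Ideal.quotientMap_mk, eq_comm, Ideal.Quotient.mk_eq_mk_iff_sub_mem,
      Ideal.mem_span_singleton] at hq
    obtain ⟨b', hb'⟩ := hq
    exact ⟨a, b', by rw [Algebra.smul_def, ← hb', add_sub_cancel]⟩
  obtain ⟨e, he⟩ := exists_linearMap_quotient_of_bijective_quotientMap _ _ _ hiso
  have hBM : IsSMulRegular (B ⊗[A] M) f := hBreg.tensorProduct_of_quotient hsurj e he hMreg
  have hloc : IsLocalization (Algebra.algebraMapSubmonoid B (Submonoid.powers f)) Bf := by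
    rw [Algebra.algebraMapSubmonoid, Submonoid.map_powers]
    assumption
  have hlocBM : IsLocalizedModule (Submonoid.powers f)
      (LinearMap.rTensor M (IsScalarTower.toAlgHom A B Bf).toLinearMap) :=
    IsLocalizedModule.rTensor (R := A) (A := A) (Submonoid.powers f)
      (IsScalarTower.toAlgHom A B Bf).toLinearMap
  have hBinj : Function.Injective
      (LinearMap.rTensor M (IsScalarTower.toAlgHom A B Bf).toLinearMap) := by
    rw [IsLocalizedModule.injective_iff_isRegular (Submonoid.powers f)]
    rintro ⟨_, n, rfl⟩
    exact hBM.pow n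
  have hMinj : Function.Injective (TensorProduct.mk A Af M 1) := by
    rw [IsLocalizedModule.injective_iff_isRegular (Submonoid.powers f)]
    rintro ⟨_, n, rfl⟩
    exact hMreg.pow n
  obtain ⟨⟨m₀, ⟨_, n, rfl⟩⟩, hm₀⟩ :=
    IsLocalizedModule.surj (Submonoid.powers f) (TensorProduct.mk A Af M 1) x
  replace hm₀ : f ^ n • x = (1 : Af) ⊗ₜ[A] m₀ := hm₀
  have hy : (1 : B) ⊗ₜ[A] m₀ = f ^ n • y := by
    apply hBinj
    rw [map_smul, ← hxy, ← map_smul, hm₀]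
    simp
  obtain ⟨m, rfl, hm⟩ := exists_eq_pow_smul_of_one_tmul_eq_pow_smul e he hBM n hy
  rw [TensorProduct.tmul_smul] at hm₀
  have hx : x = (1 : Af) ⊗ₜ[A] m :=
    IsLocalizedModule.smul_injective (TensorProduct.mk A Af M 1)
      (⟨f ^ n, n, rfl⟩ : Submonoid.powers f) hm₀
  exact ⟨m, ⟨hx.symm, hm⟩, fun m' hm' => hMinj (hm'.1.trans hx)⟩
end

section
/- Let A and Ã be commutative rings and p : A → Ã a ring homomorphism. Let f ∈ A be such that f is not a zero divisor in A and p(f) is not a zero divisor in Ã, and such that the induced ring homomorphism A/fA → Ã/p(f)Ã is an isomorphism. Let M be an f-torsion-free A-module. Then: (a) M is a finitely generated A-module if and only if M_f is a finitely generated A_f-module and Ã ⊗_A M is a finitely generated Ã-module; (b) M is a flat A-module if and only if M_f is a flat A_f-module and Ã ⊗_A M is a flat Ã-module; (c) M is a finitely generated projective A-module if and only if M_f is a finitely generated projective A_f-module and Ã ⊗_A M is a finitely generated projective Ã-module. -/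
open scoped TensorProduct

namespace BeauvilleLaszlo

variable {A B : Type*} [CommRing A] [CommRing B] [Algebra A B]

/-- If `A/fA → B/fB` is an isomorphism and `f` is regular on `B`, then `A/fⁿA → B/fⁿB` is an
isomorphism for every `n`; its inverse gives an `A`-algebra map `B → A/fⁿA`. -/
theorem nonempty_algHom_quotient_pow {f : A} (hpf : algebraMap A B f ∈ nonZeroDivisors B)
    (hsurj : ∀ b : B, ∃ a c, b = algebraMap A B a + algebraMap A B f * c)
    (hinj : ∀ (a : A) (b : B), algebraMap A B a = algebraMap A B f * b → f ∣ a) (n : ℕ) :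
    Nonempty (B →ₐ[A] A ⧸ Ideal.span {f ^ n}) := by
  have hsurj_pow : ∀ (n : ℕ) (b : B),
      ∃ a c, b = algebraMap A B a + algebraMap A B f ^ n * c := by
    intro n
    induction n with
    | zero => exact fun b => ⟨0, b, by simp⟩
    | succ n ih =>
      intro b
      obtain ⟨a, c, rfl⟩ := ih b
      obtain ⟨a', c', rfl⟩ := hsurj c
      exact ⟨a + f ^ n * a', c', by simp only [map_add, map_mul, map_pow]; ring⟩
  have hinj_pow : ∀ (n : ℕ) (a : A) (b : B),
      algebraMap A B a = algebraMap A B f ^ n * b → f ^ n ∣ a := by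
    intro n
    induction n with
    | zero => simp
    | succ n ih =>
      intro a b hab
      rw [pow_succ', mul_assoc] at hab
      obtain ⟨a', rfl⟩ := hinj a _ hab
      rw [map_mul, mul_cancel_left_mem_nonZeroDivisors hpf] at hab
      rw [pow_succ']
      exact mul_dvd_mul_left f (ih a' b hab)
  let I : Ideal A := Ideal.span {f ^ n}
  let J : Ideal B := Ideal.span {algebraMap A B f ^ n}
  have hIJ : I ≤ J.comap (Algebra.ofId A B) := by
    rw [Ideal.span_singleton_le_iff_mem, Ideal.mem_comap, map_pow]
    exact Ideal.mem_span_singleton_self _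
  let g : (A ⧸ I) →ₐ[A] B ⧸ J := Ideal.quotientMapₐ J (Algebra.ofId A B) hIJ
  have hg : Function.Bijective g := by
    constructor
    · rw [injective_iff_map_eq_zero]
      intro x hx
      obtain ⟨a, rfl⟩ := Ideal.Quotient.mk_surjective x
      obtain ⟨b, hb⟩ := Ideal.mem_span_singleton.mp (Ideal.Quotient.eq_zero_iff_mem.mp hx)
      exact Ideal.Quotient.eq_zero_iff_mem.mpr
        (Ideal.mem_span_singleton.mpr (hinj_pow n a b hb))
    · intro y
      obtain ⟨b, rfl⟩ := Ideal.Quotient.mk_surjective y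
      obtain ⟨a, c, rfl⟩ := hsurj_pow n b
      refine ⟨Ideal.Quotient.mk I a, Ideal.Quotient.eq.mpr ?_⟩
      refine Ideal.mem_span_singleton.mpr ⟨-c, ?_⟩
      change algebraMap A B a - _ = _
      ring
  exact ⟨(AlgEquiv.ofBijective g hg).symm.toAlgHom.comp (Ideal.Quotient.mkₐ A J)⟩

/-- An `f`-power torsion module vanishes as soon as its base change to `B` does. -/
theorem subsingleton_of_subsingleton_tensor {f : A}
    (φ : ∀ n : ℕ, Nonempty (B →ₐ[A] A ⧸ Ideal.span {f ^ n}))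
    {Q : Type*} [AddCommGroup Q] [Module A Q] (hQ : ∀ q : Q, ∃ n : ℕ, f ^ n • q = 0)
    [Subsingleton (B ⊗[A] Q)] : Subsingleton Q := by
  refine subsingleton_of_forall_eq 0 fun q => ?_
  have hq : q ∈ Submodule.span A {q} := Submodule.mem_span_singleton_self q
  obtain ⟨N, hN, hle, h⟩ := (Submodule.fg_span_singleton (R := A) q).exists_rTensor_fg_inclusion_eq
    (M := B) (x := ⟨q, hq⟩ ⊗ₜ 1) (y := 0)
    ((TensorProduct.comm A Q B).injective (Subsingleton.elim _ _))
  obtain ⟨n, hn⟩ : ∃ n : ℕ, ∀ x ∈ N, f ^ n • x = 0 := by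
    obtain ⟨s, rfl⟩ := hN
    choose k hk using hQ
    refine ⟨s.sup k, fun x hx => ?_⟩
    induction hx using Submodule.span_induction with
    | mem x hx =>
      rw [← Nat.sub_add_cancel (Finset.le_sup (f := k) hx), pow_add, mul_smul, hk, smul_zero]
    | zero => simp
    | add x y _ _ hx hy => rw [smul_add, hx, hy, add_zero]
    | smul a x _ hx => rw [smul_comm, hx, smul_zero]
  obtain ⟨ψ⟩ := φ n
  have hzero : (Ideal.span {f ^ n} : Ideal A) • (⊤ : Submodule A N) = ⊥ := by
    rw [eq_bot_iff, Submodule.smul_le]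
    intro a ha x _
    obtain ⟨c, rfl⟩ := Ideal.mem_span_singleton.mp ha
    have hx : f ^ n • x = 0 := Subtype.ext (hn x x.2)
    rw [Submodule.mem_bot, mul_comm, mul_smul, hx, smul_zero]
  have hψ := congrArg (fun t => TensorProduct.tensorQuotEquivQuotSMul N (Ideal.span {f ^ n})
    (ψ.toLinearMap.lTensor N t)) h
  simp only [LinearMap.rTensor_tmul, LinearMap.lTensor_tmul, map_zero, AlgHom.toLinearMap_apply,
    map_one] at hψ
  rw [← map_one (Ideal.Quotient.mk (Ideal.span {f ^ n}))] at hψ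
  rw [TensorProduct.tensorQuotEquivQuotSMul_tmul_mk, one_smul, Submodule.Quotient.mk_eq_zero,
    hzero, Submodule.mem_bot] at hψ
  exact congrArg Subtype.val hψ

/-- A finite base change `C ⊗ M` is generated by the image of a finitely generated submodule
of `M`. -/
theorem exists_fg_subsingleton_tensor_quotient (C : Type*) [CommRing C] [Algebra A C]
    (M : Type*) [AddCommGroup M] [Module A M] [Module.Finite C (C ⊗[A] M)] :
    ∃ N : Submodule A M, N.FG ∧
      ∀ N' : Submodule A M, N ≤ N' → Subsingleton (C ⊗[A] (M ⧸ N')) := by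
  obtain ⟨s, hs⟩ := (Module.Finite.fg_top : (⊤ : Submodule C (C ⊗[A] M)).FG)
  obtain ⟨N, hN, hsN⟩ := TensorProduct.exists_finite_submodule_right_of_setFinite
    (s : Set (C ⊗[A] M)) s.finite_toSet
  refine ⟨N, Module.Finite.iff_fg.mp hN, fun N' hle => ?_⟩
  have hzero : N'.mkQ.baseChange C = 0 := by
    refine LinearMap.ext_on_range (v := ((↑) : s → C ⊗[A] M)) (by simpa using hs) fun x => ?_
    obtain ⟨y, hy⟩ := hsN x.2
    rw [← hy, LinearMap.zero_apply]
    change (N'.mkQ.lTensor C) (N.subtype.lTensor C y) = 0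
    rw [← LinearMap.lTensor_comp_apply]
    have : N'.mkQ ∘ₗ N.subtype = 0 := by
      ext x
      simpa using hle x.2
    rw [this, LinearMap.lTensor_zero, LinearMap.zero_apply]
  refine subsingleton_of_forall_eq 0 fun z => ?_
  obtain ⟨y, rfl⟩ := LinearMap.lTensor_surjective C N'.mkQ_surjective z
  exact LinearMap.congr_fun hzero y

theorem finite_of_finite_tensor {f : A}
    (φ : ∀ n : ℕ, Nonempty (B →ₐ[A] A ⧸ Ideal.span {f ^ n}))
    (Af : Type*) [CommRing Af] [Algebra A Af] [IsLocalization.Away f Af]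
    (M : Type*) [AddCommGroup M] [Module A M]
    [Module.Finite Af (Af ⊗[A] M)] [Module.Finite B (B ⊗[A] M)] : Module.Finite A M := by
  obtain ⟨N₁, hN₁, h₁⟩ := exists_fg_subsingleton_tensor_quotient (A := A) Af M
  obtain ⟨N₂, hN₂, h₂⟩ := exists_fg_subsingleton_tensor_quotient (A := A) B M
  have := h₁ _ (le_sup_left : N₁ ≤ N₁ ⊔ N₂)
  have := h₂ _ (le_sup_right : N₂ ≤ N₁ ⊔ N₂)
  have : Subsingleton (M ⧸ N₁ ⊔ N₂) := by
    refine subsingleton_of_subsingleton_tensor (B := B) φ fun q => ?_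
    obtain ⟨⟨_, n, rfl⟩, h⟩ := (IsLocalizedModule.eq_zero_iff (Submonoid.powers f)
      (TensorProduct.mk A Af (M ⧸ N₁ ⊔ N₂) 1) (m := q)).mp (Subsingleton.elim _ 0)
    exact ⟨n, h⟩
  rw [Submodule.Quotient.subsingleton_iff] at this
  exact ⟨this ▸ hN₁.sup hN₂⟩

theorem one_tmul_quotient_span_singleton_eq_zero_iff {f : A} {P : Type*} [AddCommGroup P]
    [Module A P] (y : P) :
    (1 : A ⧸ Ideal.span {f}) ⊗ₜ[A] y = 0 ↔ ∃ z, f • z = y := by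
  rw [← (TensorProduct.quotTensorEquivQuotSMul P (Ideal.span {f})).map_eq_zero_iff,
    TensorProduct.quotTensorEquivQuotSMul_mk_one_tmul, Submodule.Quotient.mk_eq_zero,
    Submodule.ideal_span_singleton_smul, Submodule.mem_smul_pointwise_iff_exists]
  simp

/-- If `C ⊗ M` is flat over `C` and `C ⊗ i` is injective, then so is `C ⊗ (i ⊗ M)`. -/
theorem baseChange_rTensor_injective (C : Type*) [CommRing C] [Algebra A C] {K F M : Type*}
    [AddCommGroup K] [Module A K] [AddCommGroup F] [Module A F] [AddCommGroup M] [Module A M]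
    [Module.Flat C (C ⊗[A] M)] (i : K →ₗ[A] F) (hi : Function.Injective (i.baseChange C)) :
    Function.Injective ((i.rTensor M).baseChange C) := by
  have hdistrib : (TensorProduct.AlgebraTensorModule.distribBaseChange A C F M).toLinearMap ∘ₗ
      (i.rTensor M).baseChange C = (i.baseChange C).rTensor (C ⊗[A] M) ∘ₗ
        (TensorProduct.AlgebraTensorModule.distribBaseChange A C K M).toLinearMap := by
    ext k m
    simp
  refine Function.Injective.of_comp
    (f := TensorProduct.AlgebraTensorModule.distribBaseChange A C F M) ?_
  rw [← LinearEquiv.coe_toLinearMap, ← LinearMap.coe_comp, hdistrib]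
  exact (Module.Flat.rTensor_preserves_injective_linearMap (M := C ⊗[A] M) _ hi).comp
    (LinearEquiv.injective _)

theorem smul_tensor_injective_of_flat {f : A} {F M : Type*} [AddCommGroup M] [Module A M]
    [AddCommGroup F] [Module A F] [Module.Flat A F]
    (hM : Function.Injective fun m : M => f • m) :
    Function.Injective fun t : F ⊗[A] M => f • t := by
  have h : (LinearMap.lsmul A M f).lTensor F = LinearMap.lsmul A (F ⊗[A] M) f := by
    ext
    simp
  have := Module.Flat.lTensor_preserves_injective_linearMap (M := F) (LinearMap.lsmul A M f) hM
  rwa [h] at this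

/-- If `M` is `f`-torsion-free and `M/fM` is flat over `A/fA`, then tensoring with `M` preserves
`f`-torsion-freeness of quotients of flat modules, hence of all modules. -/
theorem eq_zero_of_smul_tensor_eq_zero {f : A} {F M N : Type*} [AddCommGroup M] [Module A M]
    [AddCommGroup N] [Module A N] [AddCommGroup F] [Module A F] [Module.Flat A F]
    (hM : Function.Injective fun m : M => f • m)
    [Module.Flat (A ⧸ Ideal.span {f}) ((A ⧸ Ideal.span {f}) ⊗[A] M)]
    (hN : ∀ n : N, f • n = 0 → n = 0) (π : F →ₗ[A] N) (hπ : Function.Surjective π)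
    (x : N ⊗[A] M) (hx : f • x = 0) : x = 0 := by
  let C := A ⧸ Ideal.span {f}
  let i := (LinearMap.ker π).subtype
  have hi : Function.Injective (i.baseChange C) := by
    rw [injective_iff_map_eq_zero]
    intro z hz
    obtain ⟨k, rfl⟩ := TensorProduct.mk_surjective A _ C Ideal.Quotient.mk_surjective z
    rw [TensorProduct.mk_apply, LinearMap.baseChange_tmul,
      one_tmul_quotient_span_singleton_eq_zero_iff] at hz
    obtain ⟨y, hy⟩ := hz
    have hπy : π y = 0 := hN _ (by rw [← map_smul, hy]; exact k.2)
    exact (one_tmul_quotient_span_singleton_eq_zero_iff k).mpr ⟨⟨y, hπy⟩, Subtype.ext hy⟩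
  obtain ⟨y, rfl⟩ := LinearMap.rTensor_surjective M hπ x
  have hexact : Function.Exact (i.rTensor M) (π.rTensor M) :=
    rTensor_exact M (LinearMap.exact_subtype_ker_map π) hπ
  rw [← map_smul] at hx
  obtain ⟨k, hk⟩ := (hexact _).mp hx
  obtain ⟨k', rfl⟩ : ∃ k', f • k' = k := by
    refine (one_tmul_quotient_span_singleton_eq_zero_iff k).mp ?_
    apply baseChange_rTensor_injective C i hi
    rw [LinearMap.baseChange_tmul, hk, map_zero]
    exact (one_tmul_quotient_span_singleton_eq_zero_iff _).mpr ⟨y, rfl⟩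
  rw [map_smul] at hk
  exact (hexact y).mpr ⟨k', smul_tensor_injective_of_flat hM hk⟩

theorem flat_of_flat_tensor {f : A} (hf : f ∈ nonZeroDivisors A)
    (φ : B →ₐ[A] A ⧸ Ideal.span {f})
    (Af : Type*) [CommRing Af] [Algebra A Af] [IsLocalization.Away f Af]
    (M : Type*) [AddCommGroup M] [Module A M] (hM : Function.Injective fun m : M => f • m)
    [Module.Flat Af (Af ⊗[A] M)] [Module.Flat B (B ⊗[A] M)] : Module.Flat A M := by
  have : Module.Flat (A ⧸ Ideal.span {f}) ((A ⧸ Ideal.span {f}) ⊗[A] M) := by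
    algebraize [φ.toRingHom]
    have : IsScalarTower A B (A ⧸ Ideal.span {f}) :=
      .of_algebraMap_eq fun a => (φ.commutes a).symm
    exact .of_linearEquiv (TensorProduct.AlgebraTensorModule.cancelBaseChange A B
      (A ⧸ Ideal.span {f}) (A ⧸ Ideal.span {f}) M).symm
  have : Module.Flat A Af := IsLocalization.flat Af (Submonoid.powers f)
  have : Module.Flat A (Af ⊗[A] M) := Module.Flat.trans A Af _
  rw [Module.Flat.iff_rTensor_injective']
  intro I
  rw [injective_iff_map_eq_zero]
  intro x hx
  have htors (n : ℕ) (y : I ⊗[A] M) (hy : f ^ n • y = 0) : y = 0 := by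
    induction n with
    | zero => simpa using hy
    | succ n ih =>
      rw [pow_succ', mul_smul] at hy
      refine ih (eq_zero_of_smul_tensor_eq_zero hM (fun a ha => Subtype.ext ?_)
        (Finsupp.linearCombination A (id : I → I))
        (Finsupp.linearCombination_surjective A Function.surjective_id) _ hy)
      exact (mul_left_mem_nonZeroDivisors_eq_zero_iff hf).mp (congrArg Subtype.val ha)
  have hinj := Module.Flat.rTensor_preserves_injective_linearMap (M := Af ⊗[A] M)
    I.subtype I.subtype_injective
  have hcomm (t : I ⊗[A] M) :
      TensorProduct.leftComm A I Af M ((TensorProduct.mk A Af M 1).lTensor I t) = 1 ⊗ₜ t := by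
    induction t with
    | zero => simp
    | add s t hs ht => simp only [map_add, TensorProduct.tmul_add, hs, ht]
    | tmul k m => simp
  have hzero : (TensorProduct.mk A Af M 1).lTensor I x = 0 := by
    apply hinj
    rw [map_zero, ← LinearMap.comp_apply, LinearMap.rTensor_comp_lTensor,
      ← LinearMap.lTensor_comp_rTensor, LinearMap.comp_apply, hx, map_zero]
  have hone : TensorProduct.mk A Af (I ⊗[A] M) 1 x = 0 := by
    rw [TensorProduct.mk_apply, ← hcomm, hzero, map_zero]
  obtain ⟨⟨_, n, rfl⟩, h⟩ := (IsLocalizedModule.eq_zero_iff (Submonoid.powers f)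
    (TensorProduct.mk A Af (I ⊗[A] M) 1)).mp hone
  exact htors n x h

/-- The kernel of a surjection from a finite module onto a flat module stays finite after any
base change making the target finitely presented. -/
theorem finite_tensor_ker (C : Type*) [CommRing C] [Algebra A C] {F M : Type*} [AddCommGroup F]
    [Module A F] [Module.Finite A F] [AddCommGroup M] [Module A M] [Module.Flat A M]
    [Module.FinitePresentation C (C ⊗[A] M)] (π : F →ₗ[A] M) (hπ : Function.Surjective π) :
    Module.Finite C (C ⊗[A] LinearMap.ker π) := by
  have hfg := Module.FinitePresentation.fg_ker (π.baseChange C) (LinearMap.lTensor_surjective C hπ)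
  let i := (LinearMap.ker π).subtype.baseChange C
  have hi : Function.Injective i := LinearMap.lTensor_injective_of_exact_of_flat π hπ _
    (LinearMap.ker π).subtype_injective (LinearMap.exact_subtype_ker_map π) C
  have hrange : LinearMap.range i = LinearMap.ker (π.baseChange C) :=
    (LinearMap.exact_iff.mp (show Function.Exact i (π.baseChange C) from
      lTensor_exact C (LinearMap.exact_subtype_ker_map π) hπ)).symm
  have : Module.Finite C (LinearMap.range i) := Module.Finite.iff_fg.mpr (hrange ▸ hfg)
  exact .equiv (LinearEquiv.ofInjective i hi).symm

theorem projective_of_finite_of_flat {f : A}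
    (φ : ∀ n : ℕ, Nonempty (B →ₐ[A] A ⧸ Ideal.span {f ^ n}))
    (Af : Type*) [CommRing Af] [Algebra A Af] [IsLocalization.Away f Af]
    (M : Type*) [AddCommGroup M] [Module A M] [Module.Finite A M] [Module.Flat A M]
    [Module.Projective Af (Af ⊗[A] M)] [Module.Projective B (B ⊗[A] M)] :
    Module.Projective A M := by
  obtain ⟨n, π, hπ⟩ := Module.Finite.exists_fin' A M
  have := Module.finitePresentation_of_projective Af (Af ⊗[A] M)
  have := Module.finitePresentation_of_projective B (B ⊗[A] M)
  have := finite_tensor_ker Af π hπ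
  have := finite_tensor_ker B π hπ
  have : Module.Finite A (LinearMap.ker π) := finite_of_finite_tensor (B := B) φ Af _
  have : Module.FinitePresentation A M :=
    Module.finitePresentation_of_surjective π hπ (Module.Finite.iff_fg.mp this)
  exact Module.Flat.projective_of_finitePresentation

end BeauvilleLaszlo

/-- Beauville–Laszlo, part (3).  With `p : A → B`, `f` a nonzerodivisor of
`A`, `p f` a nonzerodivisor of `B`, and `A/fA ≅ B/(p f)B`, let `M` be an `f`-torsion-free
`A`-module.  Then `M` is finitely generated (resp. flat, resp. finite projective) over `A` if
and only if both `M_f = A_f ⊗[A] M` and `B ⊗[A] M` have the corresponding property. -/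
theorem stmt6 {A B : Type*} [CommRing A] [CommRing B] [Algebra A B] (f : A)
    (hf : f ∈ nonZeroDivisors A) (hpf : algebraMap A B f ∈ nonZeroDivisors B)
    (hiso : Function.Bijective
      (Ideal.quotientMap (Ideal.span {algebraMap A B f}) (algebraMap A B)
        ((Ideal.span_singleton_le_iff_mem _).mpr
          (Ideal.mem_comap.mpr (Ideal.mem_span_singleton_self _)))))
    (Af : Type*) [CommRing Af] [Algebra A Af] [IsLocalization.Away f Af]
    (M : Type*) [AddCommGroup M] [Module A M]
    (hM : Function.Injective fun m : M => f • m) :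
    (Module.Finite A M ↔ Module.Finite Af (Af ⊗[A] M) ∧ Module.Finite B (B ⊗[A] M)) ∧
    (Module.Flat A M ↔ Module.Flat Af (Af ⊗[A] M) ∧ Module.Flat B (B ⊗[A] M)) ∧
    ((Module.Finite A M ∧ Module.Projective A M) ↔
      (Module.Finite Af (Af ⊗[A] M) ∧ Module.Projective Af (Af ⊗[A] M)) ∧
      (Module.Finite B (B ⊗[A] M) ∧ Module.Projective B (B ⊗[A] M))) := by
  have φ : ∀ n : ℕ, Nonempty (B →ₐ[A] A ⧸ Ideal.span {f ^ n}) := by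
    refine BeauvilleLaszlo.nonempty_algHom_quotient_pow hpf (fun b => ?_) fun a b hab => ?_
    · obtain ⟨x, hx⟩ := hiso.2 (Ideal.Quotient.mk _ b)
      obtain ⟨a, rfl⟩ := Ideal.Quotient.mk_surjective x
      rw [Ideal.quotientMap_mk, Eq.comm, Ideal.Quotient.eq, Ideal.mem_span_singleton] at hx
      obtain ⟨c, hc⟩ := hx
      exact ⟨a, c, by rw [← hc]; ring⟩
    · rw [← Ideal.mem_span_singleton, ← Ideal.Quotient.eq_zero_iff_mem]
      apply hiso.1
      rw [Ideal.quotientMap_mk, map_zero, Ideal.Quotient.eq_zero_iff_mem, hab]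
      exact Ideal.mul_mem_right _ _ (Ideal.mem_span_singleton_self _)
  have φ₁ : Nonempty (B →ₐ[A] A ⧸ Ideal.span {f}) := pow_one f ▸ φ 1
  have finite (_ : Module.Finite Af (Af ⊗[A] M)) (_ : Module.Finite B (B ⊗[A] M)) :
      Module.Finite A M := BeauvilleLaszlo.finite_of_finite_tensor (B := B) φ Af M
  have flat (_ : Module.Flat Af (Af ⊗[A] M)) (_ : Module.Flat B (B ⊗[A] M)) :
      Module.Flat A M := BeauvilleLaszlo.flat_of_flat_tensor hf φ₁.some Af M hM
  refine ⟨⟨fun _ => ⟨inferInstance, inferInstance⟩, fun h => finite h.1 h.2⟩,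
    ⟨fun _ => ⟨inferInstance, inferInstance⟩, fun h => flat h.1 h.2⟩,
    ⟨fun ⟨_, _⟩ => ⟨⟨inferInstance, inferInstance⟩, inferInstance, inferInstance⟩, ?_⟩⟩
  rintro ⟨⟨hfin, _⟩, hfin', _⟩
  have hA := finite hfin hfin'
  have := flat inferInstance inferInstance
  exact ⟨hA, BeauvilleLaszlo.projective_of_finite_of_flat (B := B) φ Af M⟩
end

section
/- Let k be a field and n ≥ 1. Let Λ₁ and Λ₂ be two lattices in k((t))^n, i.e. finitely generated k⟦t⟧-submodules of k((t))^n each of which spans k((t))^n as a k((t))-module. Then Λ₁ and Λ₂ are commensurable: the quotient k-vector spaces Λ₁/(Λ₁ ∩ Λ₂) and Λ₂/(Λ₁ ∩ Λ₂) are finite-dimensional over k. -/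
open PowerSeries in
/-- A finitely generated `k⟦X⟧`-module all of whose elements are killed by a power of `X` is
finite-dimensional over `k`. -/
theorem PowerSeries.finite_of_X_pow_smul_eq_zero_s7 {k M : Type*} [Field k] [AddCommGroup M]
    [Module k M] [Module k⟦X⟧ M] [IsScalarTower k k⟦X⟧ M] [Module.Finite k⟦X⟧ M]
    (h : ∀ x : M, ∃ m : ℕ, (X : k⟦X⟧) ^ m • x = 0) : Module.Finite k M := by
  classical
  obtain ⟨s, hs⟩ := Module.Finite.fg_top (R := k⟦X⟧) (M := M)
  choose m hm using h
  let T : Finset M := s.biUnion fun x ↦ (Finset.range (m x)).image fun i ↦ (X : k⟦X⟧) ^ i • x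
  have key : ∀ x ∈ s, ∀ f : k⟦X⟧, f • x ∈ Submodule.span k (T : Set M) := by
    intro x hx f
    have htrunc : ((trunc (m x) f : Polynomial k) : k⟦X⟧) =
        ∑ i ∈ Finset.range (m x), coeff i f • (X : k⟦X⟧) ^ i := by
      ext j
      simp [coeff_trunc, coeff_X_pow]
    rw [eq_shift_mul_X_pow_add_trunc (m x) f, add_smul, mul_smul, hm, smul_zero, zero_add, htrunc,
      Finset.sum_smul]
    refine Submodule.sum_mem _ fun i hi ↦ ?_
    rw [smul_assoc]
    exact Submodule.smul_mem _ _ (Submodule.subset_span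
      (Finset.mem_biUnion.2 ⟨x, hx, Finset.mem_image_of_mem _ hi⟩))
  refine ⟨⟨T, eq_top_iff.2 fun y _ ↦ ?_⟩⟩
  obtain ⟨c, -, rfl⟩ := Submodule.mem_span_finset.1 (hs ▸ Submodule.mem_top : y ∈ _)
  exact Submodule.sum_mem _ fun x hx ↦ key x hx (c x)

open PowerSeries in
/-- If a `k⟦X⟧`-submodule spans `V` over the fraction field of `k⟦X⟧`, then every vector of `V`
is carried into it by a power of `X`. -/
theorem PowerSeries.exists_X_pow_smul_mem {k K V : Type*} [Field k] [Field K] [Algebra k⟦X⟧ K]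
    [IsFractionRing k⟦X⟧ K] [AddCommGroup V] [Module K V] [Module k⟦X⟧ V]
    [IsScalarTower k⟦X⟧ K V] {L : Submodule k⟦X⟧ V}
    (hL : Submodule.span K (L : Set V) = ⊤) (v : V) : ∃ m : ℕ, (X : k⟦X⟧) ^ m • v ∈ L := by
  have hv : v ∈ Submodule.span K (L : Set V) := hL ▸ Submodule.mem_top
  induction hv using Submodule.span_induction with
  | mem x hx => exact ⟨0, by simpa using hx⟩
  | zero => exact ⟨0, by simp⟩
  | add x y _ _ hx hy =>
    obtain ⟨a, ha⟩ := hx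
    obtain ⟨b, hb⟩ := hy
    refine ⟨a + b, ?_⟩
    rw [smul_add]
    refine L.add_mem ?_ ?_
    · rw [add_comm, pow_add, mul_smul]
      exact L.smul_mem _ ha
    · rw [pow_add, mul_smul]
      exact L.smul_mem _ hb
  | smul c x _ hx =>
    obtain ⟨a, ha⟩ := hx
    obtain ⟨p, q, hq, rfl⟩ := IsFractionRing.div_surjective (A := k⟦X⟧) c
    have hq0 : q ≠ 0 := nonZeroDivisors.ne_zero hq
    obtain ⟨b, u, hu⟩ := IsDiscreteValuationRing.eq_unit_mul_pow_irreducible hq0 X_irreducible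
    have hq0' : algebraMap k⟦X⟧ K q ≠ 0 := IsFractionRing.to_map_ne_zero_of_mem_nonZeroDivisors hq
    have hX : (X : k⟦X⟧) ^ b = (↑u⁻¹ : k⟦X⟧) * q := by
      rw [hu, Units.inv_mul_cancel_left]
    refine ⟨a + b, ?_⟩
    have : (X : k⟦X⟧) ^ (a + b) • (algebraMap k⟦X⟧ K p / algebraMap k⟦X⟧ K q) • x =
        ((↑u⁻¹ : k⟦X⟧) * p) • (X : k⟦X⟧) ^ a • x := by
      rw [← algebraMap_smul K (X ^ (a + b) : k⟦X⟧), ← algebraMap_smul K (_ * p),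
        ← algebraMap_smul K (X ^ a : k⟦X⟧), smul_smul, smul_smul, pow_add, hX]
      congr 1
      simp only [map_mul]
      field_simp
    rw [this]
    exact L.smul_mem _ ha

open PowerSeries in
/-- A finitely generated `k⟦X⟧`-submodule is, modulo its intersection with a lattice,
finite-dimensional over `k`. -/
theorem PowerSeries.finite_quotient_comap_subtype {k K V : Type*} [Field k] [Field K]
    [Algebra k⟦X⟧ K] [IsFractionRing k⟦X⟧ K] [AddCommGroup V] [Module K V] [Module k⟦X⟧ V]
    [Module k V] [IsScalarTower k k⟦X⟧ V] [IsScalarTower k⟦X⟧ K V] {L L' : Submodule k⟦X⟧ V}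
    (hfg : L.FG) (hL' : Submodule.span K (L' : Set V) = ⊤) :
    Module.Finite k (L ⧸ L'.comap L.subtype) := by
  have : Module.Finite k⟦X⟧ L := Module.Finite.iff_fg.2 hfg
  refine finite_of_X_pow_smul_eq_zero_s7 fun y ↦ ?_
  obtain ⟨x, rfl⟩ := Submodule.Quotient.mk_surjective _ y
  obtain ⟨m, hm⟩ := exists_X_pow_smul_mem hL' (x : V)
  refine ⟨m, ?_⟩
  rw [← Submodule.Quotient.mk_smul, Submodule.Quotient.mk_eq_zero]
  simpa using hm

/-- Let `k` be a field, `n ≥ 1`, and let `K = k((t))` be the field of formal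
Laurent series over `k`, i.e. the fraction field of the power series ring `k⟦t⟧` (Mathlib's
`LaurentSeries k` is such a field, via the instance `IsFractionRing K⟦X⟧ K⸨X⸩`).  Any two
lattices `Λ₁, Λ₂` in `k((t))ⁿ` — finitely generated `k⟦t⟧`-submodules whose `k((t))`-linear
span is all of `k((t))ⁿ` — are commensurable: the quotients `Λ₁/(Λ₁ ∩ Λ₂)` and
`Λ₂/(Λ₁ ∩ Λ₂)` are finite-dimensional `k`-vector spaces. -/
theorem stmt7 (k : Type*) [Field k] (K : Type*) [Field K] [Algebra k K]
    [Algebra (PowerSeries k) K] [IsScalarTower k (PowerSeries k) K]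
    [IsFractionRing (PowerSeries k) K] (n : ℕ) (hn : 1 ≤ n)
    (Λ₁ Λ₂ : Submodule (PowerSeries k) (Fin n → K))
    (h₁fg : Λ₁.FG) (h₂fg : Λ₂.FG)
    (h₁span : Submodule.span K (Λ₁ : Set (Fin n → K)) = ⊤)
    (h₂span : Submodule.span K (Λ₂ : Set (Fin n → K)) = ⊤) :
    FiniteDimensional k (Λ₁ ⧸ (Λ₁ ⊓ Λ₂).comap Λ₁.subtype) ∧
    FiniteDimensional k (Λ₂ ⧸ (Λ₁ ⊓ Λ₂).comap Λ₂.subtype) := by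
  have e₁ : (Λ₁ ⊓ Λ₂).comap Λ₁.subtype = Λ₂.comap Λ₁.subtype := by simp
  have e₂ : (Λ₁ ⊓ Λ₂).comap Λ₂.subtype = Λ₁.comap Λ₂.subtype := by simp
  rw [e₁, e₂]
  exact ⟨PowerSeries.finite_quotient_comap_subtype h₁fg h₂span,
    PowerSeries.finite_quotient_comap_subtype h₂fg h₁span⟩
end

section
/- For all natural numbers n ≥ 1, m ≥ 0 and g ≥ 0, the real number (n/(n+m))^g · Σ_S Π_{s ∈ S, t ∉ S} |2 sin(π (s−t)/(m+n))|^{g−1} is a positive integer, where the sum runs over all subsets S of {1, 2, …, m+n} of cardinality n, the product runs over all pairs (s,t) with s ∈ S and t ∈ {1, …, m+n} \ S, and the exponent g−1 is taken as an integer power (note every factor |2 sin(π(s−t)/(m+n))| is a nonzero positive real number, since 0 < |s−t| < m+n). -/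
open Finset Polynomial

/-- The product of `1 - w * z ^ (N - 1)` over `z ∈ S` and `w ∈ U \ S`; when `U` consists of
`N`-th roots of unity this is the product of all `1 - w / z`. -/
def crossProd {R : Type*} [CommRing R] [DecidableEq R] (N : ℕ) (U S : Finset R) : R :=
  ∏ z ∈ S, ∏ w ∈ U \ S, (1 - w * z ^ (N - 1))

/-- A divisibility consequence of Newton's identities. -/
theorem dvd_card_mul_prod_of_dvd_sum_pow {R σ : Type*} [CommRing R] [Fintype σ] (f : σ → R)
    (d : R) (h : ∀ k, 0 < k → d ∣ ∑ i, f i ^ k) : d ∣ Fintype.card σ * ∏ i, f i := by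
  have newton := congrArg (MvPolynomial.aeval f)
    (MvPolynomial.mul_esymm_eq_sum σ R (Fintype.card σ))
  have top : MvPolynomial.aeval f (MvPolynomial.esymm σ R (Fintype.card σ)) = ∏ i, f i := by
    rw [MvPolynomial.esymm, ← Finset.card_univ, Finset.powersetCard_self]
    simp
  rw [map_mul, map_natCast, top] at newton
  rw [newton, map_mul, map_sum]
  refine Dvd.dvd.mul_left (Finset.dvd_sum fun a ha => ?_) _
  obtain ⟨ha, hlt⟩ := Finset.mem_filter.mp ha
  rw [map_mul]
  refine Dvd.dvd.mul_left ?_ _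
  have hpos : 0 < a.2 := by
    have := HasAntidiagonal.mem_antidiagonal.mp ha
    omega
  simpa [MvPolynomial.psum] using h a.2 hpos

theorem sum_powersetCard_image {α β M : Type*} [DecidableEq β] [AddCommMonoid M]
    {e : α → β} {U : Finset α} (he : Set.InjOn e U) (n : ℕ) (f : Finset β → M) :
    ∑ T ∈ powersetCard n (U.image e), f T = ∑ S ∈ powersetCard n U, f (S.image e) := by
  symm
  refine Finset.sum_bij (fun S _ => S.image e) ?_ ?_ ?_ (fun _ _ => rfl)
  · intro S hS
    rw [mem_powersetCard] at hS ⊢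
    exact ⟨image_subset_image hS.1,
      (card_image_of_injOn (he.mono (by exact_mod_cast hS.1))).trans hS.2⟩
  · intro S hS T hT h
    rw [mem_powersetCard] at hS hT
    have h' : e '' (S : Set α) = e '' (T : Set α) := by
      rw [← coe_image, ← coe_image, h]
    exact_mod_cast (he.image_eq_image_iff (by exact_mod_cast hS.1)
      (by exact_mod_cast hT.1)).mp h'
  · intro T hT
    rw [mem_powersetCard] at hT
    obtain ⟨S, hS, rfl⟩ := subset_image_iff.mp hT.1
    have hS' : S ⊆ U := by exact_mod_cast hS
    refine ⟨S, ?_, rfl⟩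
    rw [mem_powersetCard]
    exact ⟨hS', (card_image_of_injOn (he.mono (by exact_mod_cast hS'))).symm.trans hT.2⟩

section Domain

variable {R : Type*} [CommRing R] [IsDomain R]

theorem sum_nthRootsFinset_pow {ζ : R} {N : ℕ} (hN : 0 < N) (hζ : IsPrimitiveRoot ζ N) (i : ℕ) :
    ∑ z ∈ nthRootsFinset N (1 : R), z ^ i = if N ∣ i then (N : R) else 0 := by
  split_ifs with h
  · obtain ⟨j, rfl⟩ := h
    rw [sum_congr rfl (g := fun _ => (1 : R)), sum_const, hζ.card_nthRootsFinset,
      nsmul_eq_mul, mul_one]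
    intro z hz
    rw [pow_mul, (mem_nthRootsFinset hN 1).mp hz, one_pow]
  · have hrot : ∑ z ∈ nthRootsFinset N (1 : R), (ζ * z) ^ i =
        ∑ z ∈ nthRootsFinset N (1 : R), z ^ i := by
      refine Finset.sum_nbij (ζ * ·) ?_ ?_ ?_ (fun _ _ => rfl)
      · intro z hz
        rw [mem_nthRootsFinset hN] at hz ⊢
        rw [mul_pow, hz, hζ.pow_eq_one, mul_one]
      · exact fun _ _ _ _ h => mul_left_cancel₀ (hζ.ne_zero hN.ne') h
      · intro z hz
        rw [mem_coe, mem_nthRootsFinset hN] at hz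
        refine ⟨ζ ^ (N - 1) * z, ?_, ?_⟩
        · rw [mem_coe, mem_nthRootsFinset hN, mul_pow, hz, ← pow_mul, mul_comm (N - 1), pow_mul,
            hζ.pow_eq_one, one_pow, mul_one]
        · simp only
          rw [← mul_assoc, mul_pow_sub_one hN.ne', hζ.pow_eq_one, one_mul]
    simp_rw [mul_pow] at hrot
    rw [← mul_sum] at hrot
    have hne : ζ ^ i - 1 ≠ 0 := fun h0 => h ((hζ.pow_eq_one_iff_dvd i).mp (sub_eq_zero.mp h0))
    refine (mul_eq_zero.mp ?_).resolve_left hne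
    rw [sub_mul, hrot, one_mul, sub_self]

theorem dvd_sum_eval_nthRootsFinset {ζ : R} {N : ℕ} (hN : 0 < N) (hζ : IsPrimitiveRoot ζ N)
    (j : ℕ) (p : R[X]) : (N : R) ∣ ∑ z ∈ nthRootsFinset N (1 : R), p.eval (z ^ j) := by
  simp_rw [eval_eq_sum_range, ← pow_mul]
  rw [sum_comm]
  refine Finset.dvd_sum fun i _ => ?_
  rw [← mul_sum, sum_nthRootsFinset_pow hN hζ]
  refine Dvd.dvd.mul_left ?_ _
  split_ifs
  · exact dvd_rfl
  · exact dvd_zero _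

variable [DecidableEq R]

/-- The power sums of the partial products are character sums over all `N`-th roots of unity, hence
divisible by `N`. -/
theorem dvd_card_mul_crossProd {ζ : R} {N : ℕ} (hN : 0 < N) (hζ : IsPrimitiveRoot ζ N)
    {S : Finset R} (hS : S ⊆ nthRootsFinset N (1 : R)) :
    (N : R) ∣ #S * crossProd N (nthRootsFinset N (1 : R)) S := by
  set U := nthRootsFinset N (1 : R) with hU
  let r : R[X] := ∏ w ∈ U \ S, (1 - C w * X)
  have hr : ∀ x, r.eval x = ∏ w ∈ U \ S, (1 - w * x) := fun x => by
    simp [r, eval_prod]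
  have key := dvd_card_mul_prod_of_dvd_sum_pow (fun z : S => r.eval ((z : R) ^ (N - 1))) (N : R) ?_
  · rw [Fintype.card_coe, prod_coe_sort S (fun z => r.eval (z ^ (N - 1)))] at key
    simpa only [crossProd, hr] using key
  · intro k hk
    rw [sum_coe_sort S (fun z => r.eval (z ^ (N - 1)) ^ k)]
    have hext : ∑ z ∈ S, r.eval (z ^ (N - 1)) ^ k = ∑ z ∈ U, (r ^ k).eval (z ^ (N - 1)) := by
      simp_rw [eval_pow]
      refine sum_subset hS fun z hz hzS => ?_
      rw [hr, prod_eq_zero (mem_sdiff.mpr ⟨hz, hzS⟩), zero_pow hk.ne']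
      rw [mul_pow_sub_one hN.ne', (mem_nthRootsFinset hN 1).mp hz, sub_self]
    rw [hext]
    exact dvd_sum_eval_nthRootsFinset hN hζ _ _

theorem crossProd_image_mul {N : ℕ} (hN : 0 < N) {U S : Finset R} {c : R} (hc : c ^ N = 1) :
    crossProd N (U.image (c * ·)) (S.image (c * ·)) = crossProd N U S := by
  have hc0 : c ≠ 0 := by
    rintro rfl
    simp [hN.ne'] at hc
  have hinj : Function.Injective (c * ·) := mul_right_injective₀ hc0
  unfold crossProd
  rw [← image_sdiff _ _ hinj, prod_image hinj.injOn]
  refine prod_congr rfl fun z _ => ?_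
  rw [prod_image hinj.injOn]
  refine prod_congr rfl fun w _ => ?_
  rw [mul_pow, mul_mul_mul_comm, mul_pow_sub_one hN.ne', hc, one_mul]

theorem image_mul_nthRootsFinset {N : ℕ} (hN : 0 < N) {c : R} (hc : c ^ N = 1) :
    (nthRootsFinset N (1 : R)).image (c * ·) = nthRootsFinset N (1 : R) := by
  have hc0 : c ≠ 0 := by
    rintro rfl
    simp [hN.ne'] at hc
  refine eq_of_subset_of_card_le ?_ ?_
  · intro z hz
    obtain ⟨w, hw, rfl⟩ := mem_image.mp hz
    rw [mem_nthRootsFinset hN] at hw ⊢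
    rw [mul_pow, hw, hc, one_mul]
  · rw [card_image_of_injective _ (mul_right_injective₀ hc0)]

theorem card_mul_sum_crossProd_pow {ζ : R} {N : ℕ} (hN : 0 < N) (hζ : IsPrimitiveRoot ζ N)
    (n k : ℕ) :
    (n : R) * ∑ S ∈ powersetCard n (nthRootsFinset N (1 : R)),
        crossProd N (nthRootsFinset N (1 : R)) S ^ k =
      N * ∑ S ∈ powersetCard n (nthRootsFinset N (1 : R)) with 1 ∈ S,
        crossProd N (nthRootsFinset N (1 : R)) S ^ k := by
  set U := nthRootsFinset N (1 : R) with hU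
  set F : Finset R → R := fun S => crossProd N U S ^ k with hF
  have hrot : ∀ z ∈ U, ∑ S ∈ powersetCard n U, (if z ∈ S then F S else 0) =
      ∑ S ∈ powersetCard n U, (if 1 ∈ S then F S else 0) := by
    intro z hz
    have hz1 : z ^ N = 1 := (mem_nthRootsFinset hN 1).mp hz
    have hz0 : z ≠ 0 := by
      rintro rfl
      simp [hN.ne'] at hz1
    have hinj : Function.Injective (z * ·) := mul_right_injective₀ hz0
    have himg : U.image (z * ·) = U := image_mul_nthRootsFinset hN hz1
    conv_lhs => rw [← himg]
    rw [sum_powersetCard_image hinj.injOn]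
    refine sum_congr rfl fun S _ => ?_
    have hmem : z ∈ S.image (z * ·) ↔ 1 ∈ S := by
      simpa only [mul_one] using hinj.mem_finset_image (s := S) (a := 1)
    have hcross : crossProd N U (S.image (z * ·)) = crossProd N U S := by
      conv_lhs => rw [← himg]
      exact crossProd_image_mul hN hz1
    simp only [hmem, hF, hcross]
  calc (n : R) * ∑ S ∈ powersetCard n U, F S
      = ∑ S ∈ powersetCard n U, ∑ z ∈ U, (if z ∈ S then F S else 0) := by
        rw [mul_sum]
        refine sum_congr rfl fun S hS => ?_
        obtain ⟨hSU, hcard⟩ := mem_powersetCard.mp hS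
        rw [← sum_filter, filter_mem_eq_inter, inter_eq_right.mpr hSU, sum_const, hcard,
          nsmul_eq_mul]
    _ = N * ∑ S ∈ powersetCard n U with 1 ∈ S, F S := by
        rw [sum_comm, sum_congr rfl hrot, sum_const, hζ.card_nthRootsFinset, nsmul_eq_mul,
          sum_filter]

/-- Summing over the subsets containing `1` removes one factor of `N`, and each remaining term is
divisible by `N ^ k`. -/
theorem pow_dvd_pow_mul_sum_crossProd_pow {ζ : R} {N : ℕ} (hN : 0 < N)
    (hζ : IsPrimitiveRoot ζ N) (n k : ℕ) :
    (N : R) ^ (k + 1) ∣ (n : R) ^ (k + 1) * ∑ S ∈ powersetCard n (nthRootsFinset N (1 : R)),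
        crossProd N (nthRootsFinset N (1 : R)) S ^ k := by
  rw [pow_succ (n : R), mul_assoc, card_mul_sum_crossProd_pow hN hζ, mul_left_comm, pow_succ']
  refine mul_dvd_mul_left _ ?_
  rw [mul_sum]
  refine Finset.dvd_sum fun S hS => ?_
  obtain ⟨hSU, hcard⟩ := mem_powersetCard.mp (mem_filter.mp hS).1
  rw [← mul_pow, ← hcard]
  exact pow_dvd_pow_of_dvd (dvd_card_mul_crossProd hN hζ hSU) k

theorem map_sum_crossProd_pow {R' : Type*} [CommRing R'] [IsDomain R'] [DecidableEq R']
    (φ : R →+* R') (hφ : Function.Injective φ) {ζ : R} {N : ℕ}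
    (hζ : IsPrimitiveRoot ζ N) (n k : ℕ) :
    φ (∑ S ∈ powersetCard n (nthRootsFinset N (1 : R)),
        crossProd N (nthRootsFinset N (1 : R)) S ^ k) =
      ∑ S ∈ powersetCard n (nthRootsFinset N (1 : R')),
        crossProd N (nthRootsFinset N (1 : R')) S ^ k := by
  have himg : (nthRootsFinset N (1 : R)).image φ = nthRootsFinset N (1 : R') := by
    refine eq_of_subset_of_card_le ?_ ?_
    · intro z hz
      obtain ⟨w, hw, rfl⟩ := mem_image.mp hz
      exact map_mem_nthRootsFinset_one hw φ
    · rw [card_image_of_injective _ hφ, hζ.card_nthRootsFinset,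
        (hζ.map_of_injective hφ).card_nthRootsFinset]
  rw [← himg, sum_powersetCard_image hφ.injOn, map_sum]
  refine sum_congr rfl fun S _ => ?_
  rw [map_pow, crossProd, crossProd, ← image_sdiff _ _ hφ, prod_image hφ.injOn]
  simp_rw [prod_image hφ.injOn, map_prod, map_sub, map_mul, map_pow, map_one]

end Domain

theorem exists_int_pow_mul_sum_crossProd_pow (K : Type*) [Field K] [NumberField K] {N : ℕ}
    [IsCyclotomicExtension {N} ℚ K] (hN : 0 < N) (n k : ℕ) :
    ∃ c : ℤ, (n : ℂ) ^ (k + 1) * ∑ S ∈ powersetCard n (nthRootsFinset N (1 : ℂ)),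
      crossProd N (nthRootsFinset N (1 : ℂ)) S ^ k = (N : ℂ) ^ (k + 1) * c := by
  classical
  have : NeZero N := ⟨hN.ne'⟩
  have hζ : IsPrimitiveRoot (IsCyclotomicExtension.zeta N ℚ K) N :=
    IsCyclotomicExtension.zeta_spec N ℚ K
  have hO := hζ.toInteger_isPrimitiveRoot
  have : IsGalois ℚ K := IsCyclotomicExtension.isGalois {N} ℚ K
  obtain ⟨c, hc⟩ := pow_dvd_pow_mul_sum_crossProd_pow hN hO n k
  have hinj : Function.Injective (algebraMap (NumberField.RingOfIntegers K) K) :=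
    NumberField.RingOfIntegers.coe_injective
  have hK := congrArg (algebraMap (NumberField.RingOfIntegers K) K) hc
  simp only [map_mul, map_pow, map_natCast,
    map_sum_crossProd_pow (algebraMap (NumberField.RingOfIntegers K) K) hinj hO] at hK
  have hN0 : (N : K) ^ (k + 1) ≠ 0 := pow_ne_zero _ (Nat.cast_ne_zero.mpr hN.ne')
  have hfix : ∀ σ : K ≃ₐ[ℚ] K, σ (c : K) = c := by
    intro σ
    have hσ := congrArg (σ : K →+* K) hK
    rw [map_mul, map_mul, map_sum_crossProd_pow _ σ.injective hζ] at hσ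
    simp only [map_pow, map_natCast] at hσ
    exact mul_left_cancel₀ hN0 (hσ.symm.trans hK)
  obtain ⟨q, hq⟩ := (IsGalois.mem_range_algebraMap_iff_fixed (c : K)).mpr hfix
  have hint : IsIntegral ℤ q := by
    have h : IsIntegral ℤ (algebraMap ℚ K q) := by
      rw [hq]
      exact NumberField.RingOfIntegers.isIntegral_coe c
    exact (isIntegral_algebraMap_iff (algebraMap ℚ K).injective).mp h
  obtain ⟨a, ha⟩ := IsIntegrallyClosed.isIntegral_iff.mp hint
  let φ : K →+* ℂ := (IsAlgClosed.lift : K →ₐ[ℚ] ℂ).toRingHom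
  refine ⟨a, ?_⟩
  have hφ := congrArg φ hK
  rw [map_mul, map_mul, map_sum_crossProd_pow φ φ.injective hζ,
    ← NumberField.RingOfIntegers.coe_eq_algebraMap, ← hq, ← ha] at hφ
  simpa using hφ
theorem card_filter_image_eq {α : Type*} [DecidableEq α] {n : ℕ} {U S : Finset α}
    (hS : S ∈ powersetCard n U) :
    #{v ∈ Fintype.piFinset fun _ : Fin n => U | univ.image v = S} = n.factorial := by
  obtain ⟨hSU, hcard⟩ := mem_powersetCard.mp hS
  have hc : Fintype.card S = n := by rw [Fintype.card_coe, hcard]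
  have e : Fin n ≃ S := (Fintype.equivFinOfCardEq hc).symm
  have himg : ({v ∈ Fintype.piFinset fun _ : Fin n => U | univ.image v = S}) =
      univ.image fun (f : Fin n ≃ S) i => (f i : α) := by
    ext v
    simp only [mem_filter, Fintype.mem_piFinset, mem_image, mem_univ, true_and]
    constructor
    · rintro ⟨-, hv⟩
      have hmem : ∀ i, v i ∈ S := fun i => hv ▸ mem_image_of_mem v (mem_univ i)
      have hsurj : Function.Surjective fun i => (⟨v i, hmem i⟩ : S) := by
        rintro ⟨z, hz⟩
        rw [← hv] at hz
        obtain ⟨i, -, hi⟩ := mem_image.mp hz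
        exact ⟨i, Subtype.ext hi⟩
      have hbij := (Fintype.bijective_iff_surjective_and_card _).mpr ⟨hsurj, Fintype.card_congr e⟩
      exact ⟨Equiv.ofBijective _ hbij, rfl⟩
    · rintro ⟨f, rfl⟩
      refine ⟨fun i => hSU (f i).2, ?_⟩
      ext z
      simp only [mem_image, mem_univ, true_and]
      constructor
      · rintro ⟨i, rfl⟩
        exact (f i).2
      · exact fun hz => ⟨f.symm ⟨z, hz⟩, by simp⟩
  rw [himg, card_image_of_injective, card_univ, Fintype.card_equiv e, Fintype.card_fin]
  intro f f' h
  exact Equiv.ext fun i => Subtype.ext (congrFun h i)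

section SelfProduct

variable {R : Type*} [CommRing R]

theorem prod_erase_nthRootsFinset [IsDomain R] [DecidableEq R] {ζ : R} {N : ℕ} (hN : 0 < N)
    (hζ : IsPrimitiveRoot ζ N) {z : R} (hz : z ∈ nthRootsFinset N (1 : R)) :
    ∏ w ∈ (nthRootsFinset N (1 : R)).erase z, (1 - w * z ^ (N - 1)) = N := by
  have hz1 : z ^ N = 1 := (mem_nthRootsFinset hN 1).mp hz
  have hprod := Polynomial.X_pow_sub_one_eq_prod hN hζ
  have hder := Lagrange.eval_nodal_derivative_eval_node_eq (v := (id : R → R)) hz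
  have hnodal : Lagrange.nodal (nthRootsFinset N (1 : R)) id = X ^ N - 1 := by
    rw [hprod]
    rfl
  rw [hnodal, Lagrange.eval_nodal] at hder
  simp only [derivative_sub, derivative_X_pow, derivative_one, sub_zero, eval_mul, eval_pow,
    eval_X, id, map_natCast, eval_natCast] at hder
  have hcard : #((nthRootsFinset N (1 : R)).erase z) = N - 1 := by
    rw [card_erase_of_mem hz, hζ.card_nthRootsFinset]
  calc ∏ w ∈ (nthRootsFinset N (1 : R)).erase z, (1 - w * z ^ (N - 1))
      = ∏ w ∈ (nthRootsFinset N (1 : R)).erase z, ((z - w) * z ^ (N - 1)) := by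
        refine prod_congr rfl fun w _ => ?_
        rw [sub_mul, mul_pow_sub_one hN.ne', hz1]
    _ = N * (z ^ (N - 1) * (z ^ (N - 1)) ^ (N - 1)) := by
        rw [prod_mul_distrib, ← hder, prod_const, hcard, mul_assoc]
    _ = N := by
        rw [mul_pow_sub_one hN.ne', ← pow_mul, mul_comm (N - 1), pow_mul, hz1, one_pow, mul_one]

theorem crossProd_mul_prod_erase [IsDomain R] [DecidableEq R] {ζ : R} {N : ℕ} (hN : 0 < N)
    (hζ : IsPrimitiveRoot ζ N) {S : Finset R} (hS : S ⊆ nthRootsFinset N (1 : R)) :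
    crossProd N (nthRootsFinset N (1 : R)) S *
      ∏ z ∈ S, ∏ w ∈ S.erase z, (1 - w * z ^ (N - 1)) = (N : R) ^ #S := by
  rw [crossProd, ← prod_mul_distrib, ← prod_const]
  refine prod_congr rfl fun z hz => ?_
  rw [← prod_erase_nthRootsFinset hN hζ (hS hz), ← prod_union]
  · congr 1
    ext w
    simp only [mem_union, mem_sdiff, mem_erase]
    grind
  · exact disjoint_sdiff_self_left.mono_right (erase_subset _ _)

theorem prod_erase_eq_det_vandermonde_mul_det_vandermonde [DecidableEq R] {N n : ℕ} (hN : 0 < N)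
    {v : Fin n → R} (hv : ∀ i, v i ^ N = 1) (hinj : Function.Injective v) :
    ∏ z ∈ univ.image v, ∏ w ∈ (univ.image v).erase z, (1 - w * z ^ (N - 1)) =
      (Matrix.vandermonde v).det * (Matrix.vandermonde fun i => v i ^ (N - 1)).det := by
  have hmul : ∀ i, v i * v i ^ (N - 1) = 1 := fun i => by rw [mul_pow_sub_one hN.ne', hv]
  rw [Matrix.det_vandermonde, Matrix.det_vandermonde, ← prod_mul_distrib, prod_image hinj.injOn]
  calc ∏ i, ∏ w ∈ (univ.image v).erase (v i), (1 - w * v i ^ (N - 1))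
      = ∏ i, ∏ j ∈ {i}ᶜ, (1 - v j * v i ^ (N - 1)) := by
        refine prod_congr rfl fun i _ => ?_
        rw [← image_erase hinj, prod_image hinj.injOn, compl_singleton]
    _ = ∏ i, ((∏ j ∈ Ioi i, (v j - v i)) * ∏ j ∈ Ioi i, (v j ^ (N - 1) - v i ^ (N - 1))) := by
        rw [← prod_prod_Ioi_mul_eq_prod_prod_off_diag fun j i => 1 - v j * v i ^ (N - 1)]
        refine prod_congr rfl fun i _ => ?_
        rw [← prod_mul_distrib]
        refine prod_congr rfl fun j _ => ?_
        linear_combination (v j * v j ^ (N - 1) - 1) * hmul i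

theorem sum_det_vandermonde_mul_det_vandermonde [IsDomain R] {ζ : R} {N n : ℕ} (hN : 0 < N)
    (hζ : IsPrimitiveRoot ζ N) (hn : n ≤ N) :
    ∑ v ∈ Fintype.piFinset fun _ : Fin n => nthRootsFinset N (1 : R),
      (Matrix.vandermonde v).det * (Matrix.vandermonde fun i => v i ^ (N - 1)).det =
      (n.factorial : R) * (N : R) ^ n := by
  have hdet : ∀ v : Fin n → R, (Matrix.vandermonde v).det =
      ∑ σ : Equiv.Perm (Fin n), ((σ.sign : ℤ) : R) * ∏ i, v i ^ (σ i : ℕ) := fun v => by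
    rw [← Matrix.det_transpose, Matrix.det_apply']
    rfl
  have horth : ∀ a b : Fin n, ∑ z ∈ nthRootsFinset N (1 : R),
      z ^ (a : ℕ) * (z ^ (N - 1)) ^ (b : ℕ) = if a = b then (N : R) else 0 := by
    intro a b
    simp_rw [← pow_mul, ← pow_add]
    rw [sum_nthRootsFinset_pow hN hζ]
    refine if_congr ?_ rfl rfl
    obtain ⟨M, rfl⟩ : ∃ M, N = M + 1 := ⟨N - 1, by omega⟩
    have ha := a.2
    have hb := b.2
    rw [← Int.natCast_dvd_natCast, Fin.ext_iff]
    have hid : ((a + (M + 1 - 1) * b : ℕ) : ℤ) = ((a : ℕ) - (b : ℕ) : ℤ) + ((M + 1 : ℕ) : ℤ) * b := by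
      push_cast [Nat.add_sub_cancel]
      ring
    rw [hid, dvd_add_left (dvd_mul_right _ _)]
    constructor
    · intro h
      have := Int.eq_zero_of_abs_lt_dvd h (by rw [abs_lt]; constructor <;> push_cast <;> omega)
      omega
    · intro h
      rw [h, sub_self]
      exact dvd_zero _
  have hpair : ∀ σ τ : Equiv.Perm (Fin n),
      ∑ v ∈ Fintype.piFinset fun _ : Fin n => nthRootsFinset N (1 : R),
        ∏ i, (v i ^ (σ i : ℕ) * (v i ^ (N - 1)) ^ (τ i : ℕ)) =
      if σ = τ then (N : R) ^ n else 0 := by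
    intro σ τ
    rw [← prod_univ_sum (fun _ => nthRootsFinset N (1 : R))
      (fun i z => z ^ (σ i : ℕ) * (z ^ (N - 1)) ^ (τ i : ℕ))]
    simp_rw [horth]
    split_ifs with h
    · simp [h]
    · obtain ⟨i, hi⟩ := not_forall.mp fun h' => h (Equiv.ext h')
      exact prod_eq_zero (mem_univ i) (if_neg hi)
  have hsign : ∀ σ : Equiv.Perm (Fin n), ((σ.sign : ℤ) : R) * ((σ.sign : ℤ) : R) = 1 := fun σ => by
    rw [← Int.cast_mul, ← Units.val_mul, Int.units_mul_self, Units.val_one, Int.cast_one]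
  simp_rw [hdet, sum_mul_sum]
  rw [sum_comm]
  calc _ = ∑ _σ : Equiv.Perm (Fin n), (N : R) ^ n := sum_congr rfl fun σ _ => ?_
    _ = _ := by rw [sum_const, card_univ, Fintype.card_perm, Fintype.card_fin, nsmul_eq_mul]
  rw [sum_comm]
  calc _ = ∑ τ : Equiv.Perm (Fin n), ((σ.sign : ℤ) : R) * ((τ.sign : ℤ) : R) *
        (if σ = τ then (N : R) ^ n else 0) := sum_congr rfl fun τ _ => by
          rw [← hpair, mul_sum]
          exact sum_congr rfl fun v _ => by rw [mul_mul_mul_comm, prod_mul_distrib]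
    _ = (N : R) ^ n := by
          simp only [mul_ite, mul_zero, sum_ite_eq, mem_univ, if_true, hsign, one_mul]

theorem sum_prod_erase_nthRootsFinset [IsDomain R] [DecidableEq R] [CharZero R] {ζ : R}
    {N n : ℕ} (hN : 0 < N) (hζ : IsPrimitiveRoot ζ N) (hn : n ≤ N) :
    ∑ S ∈ powersetCard n (nthRootsFinset N (1 : R)),
      ∏ z ∈ S, ∏ w ∈ S.erase z, (1 - w * z ^ (N - 1)) = (N : R) ^ n := by
  set U := nthRootsFinset N (1 : R) with hU
  set D : (Fin n → R) → R := fun v =>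
    (Matrix.vandermonde v).det * (Matrix.vandermonde fun i => v i ^ (N - 1)).det with hD
  set V := {v ∈ Fintype.piFinset fun _ : Fin n => U | Function.Injective v} with hV
  have hmaps : ∀ v ∈ V, univ.image v ∈ powersetCard n U := by
    intro v hv
    obtain ⟨hvU, hinj⟩ := mem_filter.mp hv
    rw [mem_powersetCard, card_image_of_injective _ hinj, card_univ, Fintype.card_fin]
    exact ⟨image_subset_iff.mpr fun i _ => Fintype.mem_piFinset.mp hvU i, rfl⟩
  have htotal : ∑ v ∈ V, D v = (n.factorial : R) * (N : R) ^ n := by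
    rw [← sum_det_vandermonde_mul_det_vandermonde hN hζ hn]
    refine sum_filter_of_ne fun v _ hne => ?_
    exact Matrix.det_vandermonde_ne_zero_iff.mp (left_ne_zero_of_mul hne)
  rw [← sum_fiberwise_of_maps_to hmaps] at htotal
  refine mul_left_cancel₀ (Nat.cast_ne_zero.mpr n.factorial_ne_zero : (n.factorial : R) ≠ 0) ?_
  rw [← htotal, mul_sum]
  refine sum_congr rfl fun S hS => ?_
  have hfilter : {v ∈ V | univ.image v = S} =
      {v ∈ Fintype.piFinset fun _ : Fin n => U | univ.image v = S} := by
    rw [hV, filter_filter]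
    refine filter_congr fun v _ => and_iff_right_of_imp fun h => ?_
    rw [← Set.injOn_univ, ← coe_univ, ← card_image_iff, h, (mem_powersetCard.mp hS).2, card_univ,
      Fintype.card_fin]
  rw [← card_filter_image_eq hS, ← hfilter, ← nsmul_eq_mul, ← sum_const]
  refine sum_congr rfl fun v hv => ?_
  obtain ⟨hvV, rfl⟩ := mem_filter.mp hv
  obtain ⟨hvU, hinj⟩ := mem_filter.mp hvV
  exact prod_erase_eq_det_vandermonde_mul_det_vandermonde hN
    (fun i => (mem_nthRootsFinset hN 1).mp (Fintype.mem_piFinset.mp hvU i)) hinj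

end SelfProduct

theorem crossProd_eq_norm {N : ℕ} (hN : 0 < N) {S : Finset ℂ}
    (hS : S ⊆ nthRootsFinset N (1 : ℂ)) :
    crossProd N (nthRootsFinset N (1 : ℂ)) S = ‖crossProd N (nthRootsFinset N (1 : ℂ)) S‖ := by
  have hζ := Complex.isPrimitiveRoot_exp N hN.ne'
  have hmul := crossProd_mul_prod_erase hN hζ hS
  let e : Fin #S ≃ S := (Fintype.equivFinOfCardEq (Fintype.card_coe S)).symm
  have hroot : ∀ i, (e i : ℂ) ^ N = 1 := fun i => (mem_nthRootsFinset hN 1).mp (hS (e i).2)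
  have hinj : Function.Injective fun i => (e i : ℂ) := Subtype.val_injective.comp e.injective
  have himg : univ.image (fun i => (e i : ℂ)) = S := by
    ext z
    simp only [mem_image, mem_univ, true_and]
    constructor
    · rintro ⟨i, rfl⟩
      exact (e i).2
    · exact fun hz => ⟨e.symm ⟨z, hz⟩, by simp⟩
  have hself := prod_erase_eq_det_vandermonde_mul_det_vandermonde hN hroot hinj
  have hconj : (Matrix.vandermonde fun i => (e i : ℂ) ^ (N - 1)).det =
      star (Matrix.vandermonde fun i => (e i : ℂ)).det := by
    have hstar : ∀ i, (e i : ℂ) ^ (N - 1) = star (e i : ℂ) := fun i => by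
      have hinv : (e i : ℂ) * (e i : ℂ) ^ (N - 1) = 1 := by rw [mul_pow_sub_one hN.ne', hroot]
      rw [← starRingEnd_apply,
        ← Complex.inv_eq_conj (Complex.norm_eq_one_of_pow_eq_one (hroot i) hN.ne')]
      exact eq_inv_of_mul_eq_one_right hinv
    simp only [Matrix.det_vandermonde, star_prod, star_sub, hstar]
  rw [himg, hconj, ← starRingEnd_apply, Complex.mul_conj, Complex.normSq_eq_norm_sq] at hself
  rw [hself] at hmul
  set d := ‖(Matrix.vandermonde fun i => (e i : ℂ)).det‖ ^ 2 with hd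
  have hN0 : (N : ℂ) ^ #S ≠ 0 := pow_ne_zero _ (Nat.cast_ne_zero.mpr hN.ne')
  have hd0 : (d : ℂ) ≠ 0 := right_ne_zero_of_mul (hmul ▸ hN0)
  have hQ : crossProd N (nthRootsFinset N (1 : ℂ)) S = (((N : ℝ) ^ #S / d : ℝ) : ℂ) := by
    rw [eq_comm]
    push_cast
    rw [div_eq_iff hd0, hmul]
  rw [hQ, Complex.norm_real, Real.norm_of_nonneg (by positivity)]

theorem sum_inv_crossProd {N n : ℕ} (hN : 0 < N) (hn : n ≤ N) :
    ∑ S ∈ powersetCard n (nthRootsFinset N (1 : ℂ)),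
      (crossProd N (nthRootsFinset N (1 : ℂ)) S)⁻¹ = 1 := by
  have hζ := Complex.isPrimitiveRoot_exp N hN.ne'
  have hN0 : (N : ℂ) ^ n ≠ 0 := pow_ne_zero _ (Nat.cast_ne_zero.mpr hN.ne')
  refine mul_left_cancel₀ hN0 ?_
  rw [mul_one, mul_sum]
  conv_rhs => rw [← sum_prod_erase_nthRootsFinset hN hζ hn]
  refine sum_congr rfl fun S hS => ?_
  obtain ⟨hSU, hcard⟩ := mem_powersetCard.mp hS
  have hmul := crossProd_mul_prod_erase hN hζ hSU
  rw [hcard] at hmul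
  have hne := left_ne_zero_of_mul (hmul ▸ hN0)
  rw [← hmul, mul_comm, inv_mul_cancel_left₀ hne]

theorem norm_one_sub_exp_pow_mul {N : ℕ} (hN : 0 < N) (s t : ℕ) :
    ‖1 - Complex.exp (2 * Real.pi * Complex.I / N) ^ t *
      (Complex.exp (2 * Real.pi * Complex.I / N) ^ s) ^ (N - 1)‖ =
      |2 * Real.sin (Real.pi * ((s : ℝ) - t) / N)| := by
  set ζ := Complex.exp (2 * Real.pi * Complex.I / N) with hζdef
  have hζ : IsPrimitiveRoot ζ N := Complex.isPrimitiveRoot_exp N hN.ne'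
  have hinv : (ζ ^ s) ^ (N - 1) = (ζ ^ s)⁻¹ := by
    refine eq_inv_of_mul_eq_one_right ?_
    rw [mul_pow_sub_one hN.ne', ← pow_mul, mul_comm, pow_mul, hζ.pow_eq_one, one_pow]
  have hexp : ζ ^ t * (ζ ^ s)⁻¹ =
      Complex.exp (Complex.I * ((2 * Real.pi * ((t : ℝ) - s) / N : ℝ) : ℂ)) := by
    rw [hζdef, ← Complex.exp_nat_mul, ← Complex.exp_nat_mul, ← Complex.exp_neg, ← Complex.exp_add]
    congr 1
    push_cast
    ring
  rw [hinv, hexp, norm_sub_rev, Complex.norm_exp_I_mul_ofReal_sub_one, Real.norm_eq_abs]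
  have harg : 2 * Real.pi * ((t : ℝ) - s) / N / 2 = -(Real.pi * ((s : ℝ) - t) / N) := by ring
  rw [harg, Real.sin_neg, mul_neg, abs_neg]

theorem IsPrimitiveRoot.injOn_pow_Icc {M : Type*} [CommMonoid M] {ζ : M} {N : ℕ}
    (hζ : IsPrimitiveRoot ζ N) : Set.InjOn (ζ ^ ·) (Icc 1 N : Finset ℕ) := by
  intro a ha b hb h
  rw [mem_coe, mem_Icc] at ha hb
  rcases ha.2.lt_or_eq with ha' | ha' <;> rcases hb.2.lt_or_eq with hb' | hb'
  · exact hζ.pow_inj ha' hb' h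
  · have hone : ζ ^ a = 1 := by simpa [hb', hζ.pow_eq_one] using h
    exact absurd (Nat.le_of_dvd ha.1 ((hζ.pow_eq_one_iff_dvd a).mp hone)) ha'.not_ge
  · have hone : ζ ^ b = 1 := by simpa [ha', hζ.pow_eq_one] using h.symm
    exact absurd (Nat.le_of_dvd hb.1 ((hζ.pow_eq_one_iff_dvd b).mp hone)) hb'.not_ge
  · rw [ha', hb']

theorem IsPrimitiveRoot.image_pow_Icc {R : Type*} [CommRing R] [IsDomain R] [DecidableEq R]
    {ζ : R} {N : ℕ} (hN : 0 < N) (hζ : IsPrimitiveRoot ζ N) :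
    (Icc 1 N).image (ζ ^ ·) = nthRootsFinset N (1 : R) := by
  refine eq_of_subset_of_card_le ?_ ?_
  · intro z hz
    obtain ⟨s, -, rfl⟩ := mem_image.mp hz
    rw [Polynomial.mem_nthRootsFinset hN, ← pow_mul, mul_comm, pow_mul, hζ.pow_eq_one, one_pow]
  · rw [card_image_of_injOn hζ.injOn_pow_Icc, hζ.card_nthRootsFinset, Nat.card_Icc,
      Nat.add_sub_cancel]

theorem prod_abs_sin_eq_crossProd {N : ℕ} (hN : 0 < N) {S : Finset ℕ} (hS : S ⊆ Icc 1 N) :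
    ((∏ s ∈ S, ∏ t ∈ Icc 1 N \ S, |2 * Real.sin (Real.pi * ((s : ℝ) - t) / N)| : ℝ) : ℂ) =
      crossProd N (nthRootsFinset N (1 : ℂ))
        (S.image fun s : ℕ => Complex.exp (2 * Real.pi * Complex.I / N) ^ s) := by
  have hinj := (Complex.isPrimitiveRoot_exp N hN.ne').injOn_pow_Icc
  have himg := (Complex.isPrimitiveRoot_exp N hN.ne').image_pow_Icc hN
  have hsub := image_subset_image hS
    (f := fun s : ℕ => Complex.exp (2 * Real.pi * Complex.I / N) ^ s)
  rw [himg] at hsub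
  rw [crossProd_eq_norm hN hsub, ← himg, crossProd, ← image_sdiff_of_injOn hinj hS,
    prod_image (hinj.mono (by exact_mod_cast hS)), norm_prod]
  congr 1
  refine prod_congr rfl fun s _ => ?_
  rw [prod_image (hinj.mono (by exact_mod_cast sdiff_subset)), norm_prod]
  exact prod_congr rfl fun t _ => (norm_one_sub_exp_pow_mul hN s t).symm

theorem prod_abs_sin_pos {N : ℕ} (hN : 0 < N) {S : Finset ℕ} (hS : S ⊆ Icc 1 N) :
    0 < ∏ s ∈ S, ∏ t ∈ Icc 1 N \ S, |2 * Real.sin (Real.pi * ((s : ℝ) - t) / N)| := by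
  refine lt_of_le_of_ne (prod_nonneg fun _ _ => prod_nonneg fun _ _ => abs_nonneg _) fun h0 => ?_
  have hcross := prod_abs_sin_eq_crossProd hN hS
  have hsub := image_subset_image hS
    (f := fun s : ℕ => Complex.exp (2 * Real.pi * Complex.I / N) ^ s)
  rw [(Complex.isPrimitiveRoot_exp N hN.ne').image_pow_Icc hN] at hsub
  have hmul := crossProd_mul_prod_erase hN (Complex.isPrimitiveRoot_exp N hN.ne') hsub
  rw [← hcross, ← h0, Complex.ofReal_zero, zero_mul] at hmul
  exact pow_ne_zero _ (Nat.cast_ne_zero.mpr hN.ne') hmul.symm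

theorem sum_prod_abs_sin_zpow {N : ℕ} (hN : 0 < N) (n : ℕ) (k : ℤ) :
    ((∑ S ∈ powersetCard n (Icc 1 N), ∏ s ∈ S, ∏ t ∈ Icc 1 N \ S,
        |2 * Real.sin (Real.pi * ((s : ℝ) - t) / N)| ^ k : ℝ) : ℂ) =
      ∑ S ∈ powersetCard n (nthRootsFinset N (1 : ℂ)),
        crossProd N (nthRootsFinset N (1 : ℂ)) S ^ k := by
  conv_rhs => rw [← (Complex.isPrimitiveRoot_exp N hN.ne').image_pow_Icc hN]
  rw [sum_powersetCard_image (Complex.isPrimitiveRoot_exp N hN.ne').injOn_pow_Icc,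
    (Complex.isPrimitiveRoot_exp N hN.ne').image_pow_Icc hN, Complex.ofReal_sum]
  refine sum_congr rfl fun S hS => ?_
  rw [← prod_abs_sin_eq_crossProd hN (mem_powersetCard.mp hS).1, ← Complex.ofReal_zpow]
  simp_rw [prod_zpow]

/-- Verlinde formula, positivity and integrality.  For `n ≥ 1` and natural
numbers `m, g`, the real number
`(n/(n+m))^g · Σ_{S ⊆ {1,…,m+n}, |S| = n} Π_{s ∈ S, t ∉ S} |2 sin(π (s−t)/(m+n))|^{g−1}`
is a positive integer (it equals `dim Γ(Bun_{SL_n}, O(m))` for a genus-`g` curve). -/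
theorem stmt10 (n m g : ℕ) (hn : 1 ≤ n) :
    ∃ N : ℕ, 0 < N ∧
      ((n : ℝ) / ((n : ℝ) + (m : ℝ))) ^ g *
        ∑ S ∈ Finset.powersetCard n (Finset.Icc 1 (m + n)),
          ∏ s ∈ S, ∏ t ∈ Finset.Icc 1 (m + n) \ S,
            |2 * Real.sin (Real.pi * ((s : ℝ) - (t : ℝ)) / ((m : ℝ) + (n : ℝ)))|
              ^ ((g : ℤ) - 1)
        = (N : ℝ) := by
  have hM : 0 < m + n := by omega
  have hcast : (m : ℝ) + n = ((m + n : ℕ) : ℝ) := by push_cast; ring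
  rw [add_comm (n : ℝ), hcast]
  set M := m + n with hMdef
  set A : ℝ := ∑ S ∈ powersetCard n (Icc 1 M), ∏ s ∈ S, ∏ t ∈ Icc 1 M \ S,
    |2 * Real.sin (Real.pi * ((s : ℝ) - t) / M)| ^ ((g : ℤ) - 1) with hA
  have hMpos : (0 : ℝ) < M := Nat.cast_pos.mpr hM
  have hpos : 0 < ((n : ℝ) / M) ^ g * A := by
    refine mul_pos (pow_pos (div_pos (Nat.cast_pos.mpr hn) hMpos) g) (sum_pos ?_ ?_)
    · intro S hS
      simp_rw [prod_zpow]
      exact zpow_pos (prod_abs_sin_pos hM (mem_powersetCard.mp hS).1) _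
    · rw [powersetCard_nonempty, Nat.card_Icc]
      omega
  suffices h : ∃ c : ℤ, ((n : ℝ) / M) ^ g * A = c by
    obtain ⟨c, hc⟩ := h
    have hc0 : 0 < c := by exact_mod_cast hc ▸ hpos
    lift c to ℕ using hc0.le
    exact ⟨c, by exact_mod_cast hc0, by exact_mod_cast hc⟩
  have hAC : (A : ℂ) = _ := sum_prod_abs_sin_zpow hM n ((g : ℤ) - 1)
  rcases g with _ | k
  · refine ⟨1, ?_⟩
    have hA1 : (A : ℂ) = 1 := by
      rw [hAC]
      simpa using sum_inv_crossProd hM (Nat.le_add_left n m)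
    rw [pow_zero, one_mul, Int.cast_one]
    exact_mod_cast hA1
  · have : @IsCyclotomicExtension {M} ℚ (CyclotomicField M ℚ) _ _ DivisionRing.toRatAlgebra := by
      rw [Subsingleton.elim (DivisionRing.toRatAlgebra : Algebra ℚ (CyclotomicField M ℚ))
        (CyclotomicField.algebra M ℚ)]
      infer_instance
    obtain ⟨c, hc⟩ := exists_int_pow_mul_sum_crossProd_pow (CyclotomicField M ℚ) hM n k
    refine ⟨c, ?_⟩
    simp only [Nat.cast_add, Nat.cast_one, add_sub_cancel_right, zpow_natCast] at hAC
    rw [← hAC] at hc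
    have hcR : (n : ℝ) ^ (k + 1) * A = (M : ℝ) ^ (k + 1) * c := by exact_mod_cast hc
    rw [div_pow, div_mul_eq_mul_div, hcR, mul_div_cancel_left₀ _ (pow_pos hMpos _).ne']
end

section
/- Let k be an algebraically closed field, n ≥ 1, and let K = k((t)) be the field of formal Laurent series over k. Then for every invertible n×n matrix A ∈ GL_n(K) there exist matrices U, V ∈ GL_n(k⟦t⟧) (i.e. n×n matrices with entries in k⟦t⟧ whose determinant is a unit of k⟦t⟧) and a non-increasing sequence of integers μ₁ ≥ μ₂ ≥ ⋯ ≥ μₙ such that A = U · diag(t^{μ₁}, …, t^{μₙ}) · V; moreover, the sequence (μ₁, …, μₙ) is uniquely determined by A. In other words, GL_n(k((t))) is the disjoint union over non-increasing integer tuples μ of the double cosets GL_n(k⟦t⟧) · t^μ · GL_n(k⟦t⟧). -/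
open Module in
/-- Smith normal form of a square matrix with nonzero determinant over a principal ideal domain. -/
theorem Matrix.exists_eq_mul_diagonal_mul {ι R : Type*} [Fintype ι] [DecidableEq ι] [CommRing R]
    [IsDomain R] [IsPrincipalIdealRing R] (B : Matrix ι ι R) (hB : B.det ≠ 0) :
    ∃ (P Q : GL ι R) (d : ι → R), (∀ i, d i ≠ 0) ∧
      B = (P : Matrix ι ι R) * Matrix.diagonal d * (Q : Matrix ι ι R) := by
  let s : Basis ι R (ι → R) := Pi.basisFun R ι
  let f : (ι → R) →ₗ[R] (ι → R) := Matrix.toLin' B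
  have hf : Function.Injective f := Matrix.mulVec_injective_of_det_ne_zero hB
  obtain ⟨b, d, c, hc⟩ := Submodule.exists_smith_normal_form_of_rank_eq s
    (LinearMap.finrank_range_of_inj hf)
  let e := LinearEquiv.ofInjective f hf
  let c' : Basis ι R (ι → R) := c.map e.symm
  have hfc (i : ι) : f (c' i) = d i • b i := by
    rw [← hc, ← LinearEquiv.ofInjective_apply (h := hf)]
    simp [c', e]
  have hdiag : LinearMap.toMatrix c' b f = Matrix.diagonal d := by
    ext i j
    rw [LinearMap.toMatrix_apply, hfc, Matrix.diagonal_apply]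
    by_cases h : i = j
    · subst h; simp
    · simp [h]
  have hmul : s.toMatrix b * Matrix.diagonal d * c'.toMatrix s = B := by
    rw [← hdiag, basis_toMatrix_mul_linearMap_toMatrix_mul_basis_toMatrix]
    exact LinearMap.toMatrix'_toLin' B
  let _ := s.invertibleToMatrix b
  let _ := c'.invertibleToMatrix s
  refine ⟨unitOfInvertible (s.toMatrix b), unitOfInvertible (c'.toMatrix s), d, fun i hi ↦ hB ?_,
    hmul.symm⟩
  rw [← hmul, Matrix.det_mul, Matrix.det_mul, Matrix.det_diagonal,
    Finset.prod_eq_zero (Finset.mem_univ i) hi, mul_zero, zero_mul]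

/-- A square matrix whose block of rows `≤ p` and columns `≥ p` vanishes is singular. -/
theorem Matrix.det_eq_zero_of_forall_le_of_forall_ge {n : ℕ} {R : Type*} [CommRing R]
    (M : Matrix (Fin n) (Fin n) R) (p : Fin n) (hM : ∀ i ≤ p, ∀ j ≥ p, M i j = 0) :
    M.det = 0 := by
  rw [← Matrix.det_transpose, Matrix.det_apply]
  refine Finset.sum_eq_zero fun σ _ ↦ ?_
  obtain ⟨i, hi, hσ⟩ : ∃ i ≤ p, p ≤ σ i := by
    by_contra! h
    have := Finset.card_le_card_of_injOn (s := Finset.Iic p) (t := Finset.Iio p) σ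
      (fun i hi ↦ by simpa using h i (by simpa using hi)) σ.injective.injOn
    simp at this
  rw [Finset.prod_eq_zero (Finset.mem_univ i) (by simpa using hM i hi _ hσ), smul_zero]

section Cartan

open PowerSeries LaurentSeries

variable {k : Type*} [Field k] {n : ℕ}

/-- A matrix over `k((t))` lies in the double coset of `t^μ` under `GL_n(k⟦t⟧)`. -/
def InCartanCell (A : Matrix (Fin n) (Fin n) k⸨X⸩) (μ : Fin n → ℤ) : Prop :=
  ∃ U V : GL (Fin n) k⟦X⟧,
    A = (U : Matrix (Fin n) (Fin n) k⟦X⟧).map (algebraMap k⟦X⟧ k⸨X⸩) *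
      Matrix.diagonal (fun i ↦ (algebraMap k⟦X⟧ k⸨X⸩ X) ^ μ i) *
      (V : Matrix (Fin n) (Fin n) k⟦X⟧).map (algebraMap k⟦X⟧ k⸨X⸩)

theorem algebraMap_X_ne_zero : algebraMap k⟦X⟧ k⸨X⸩ X ≠ 0 :=
  (map_ne_zero_iff _ (IsFractionRing.injective k⟦X⟧ k⸨X⸩)).2 X_ne_zero

/-- The exponents of a Cartan cell may be permuted. -/
theorem InCartanCell.comp_perm {A : Matrix (Fin n) (Fin n) k⸨X⸩} {μ : Fin n → ℤ}
    (h : InCartanCell A μ) (σ : Equiv.Perm (Fin n)) : InCartanCell A (μ ∘ σ) := by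
  obtain ⟨U, V, rfl⟩ := h
  have hU : IsUnit ((U : Matrix (Fin n) (Fin n) k⟦X⟧).submatrix (Equiv.refl _) σ) :=
    (Matrix.isUnit_submatrix_equiv (Equiv.refl _) σ).2 U.isUnit
  have hV : IsUnit ((V : Matrix (Fin n) (Fin n) k⟦X⟧).submatrix σ (Equiv.refl _)) :=
    (Matrix.isUnit_submatrix_equiv σ (Equiv.refl _)).2 V.isUnit
  refine ⟨hU.unit, hV.unit, ?_⟩
  rw [IsUnit.unit_spec, IsUnit.unit_spec, ← Matrix.submatrix_map, ← Matrix.submatrix_map]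
  change _ = _ * Matrix.diagonal ((fun i ↦ (algebraMap k⟦X⟧ k⸨X⸩ X) ^ μ i) ∘ σ) * _
  rw [← Matrix.submatrix_diagonal_equiv, Matrix.submatrix_mul_equiv, Matrix.submatrix_mul_equiv]
  simp

/-- Every invertible matrix over `k((t))` lies in some Cartan cell. -/
theorem exists_inCartanCell (A : GL (Fin n) k⸨X⸩) :
    ∃ μ : Fin n → ℤ, InCartanCell (A : Matrix (Fin n) (Fin n) k⸨X⸩) μ := by
  obtain ⟨⟨_, m, rfl⟩, hm⟩ := IsLocalization.exist_integer_multiples_of_finite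
    (R := k⟦X⟧) (Submonoid.powers (X : k⟦X⟧)) (fun ij : Fin n × Fin n ↦ A ij.1 ij.2)
  choose B hB using hm
  set φ := algebraMap k⟦X⟧ k⸨X⸩
  have hX : φ X ≠ 0 := algebraMap_X_ne_zero
  let B' : Matrix (Fin n) (Fin n) k⟦X⟧ := Matrix.of fun i j ↦ B (i, j)
  have hB' : B'.map φ = (φ X) ^ m • (A : Matrix (Fin n) (Fin n) k⸨X⸩) := by
    ext1 i j
    rw [Matrix.smul_apply, smul_eq_mul, ← map_pow, ← Algebra.smul_def]
    exact hB (i, j)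
  have hdet : B'.det ≠ 0 := fun h ↦ by
    have h' := congrArg φ h
    rw [RingHom.map_det, RingHom.mapMatrix_apply, hB', Matrix.det_smul, map_zero] at h'
    exact mul_ne_zero (pow_ne_zero _ (pow_ne_zero _ hX))
      ((Matrix.isUnit_iff_isUnit_det _).1 A.isUnit).ne_zero h'
  obtain ⟨P, Q, d, hd, hPQ⟩ := B'.exists_eq_mul_diagonal_mul hdet
  choose e u hu using fun i ↦
    IsDiscreteValuationRing.eq_unit_mul_pow_irreducible (hd i) (X_irreducible (R := k))
  have hD : IsUnit (Matrix.diagonal fun i ↦ (u i : k⟦X⟧)) :=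
    Matrix.isUnit_diagonal.2 (Pi.isUnit_iff.2 fun i ↦ (u i).isUnit)
  refine ⟨fun i ↦ e i - m, P * hD.unit, Q, ?_⟩
  have hA : (A : Matrix (Fin n) (Fin n) k⸨X⸩) = (φ X ^ m)⁻¹ • B'.map φ := by
    rw [hB', inv_smul_smul₀ (pow_ne_zero _ hX)]
  rw [hA, hPQ, Units.val_mul, IsUnit.unit_spec, Matrix.map_mul, Matrix.map_mul, Matrix.map_mul,
    Matrix.diagonal_map (map_zero φ), Matrix.diagonal_map (map_zero φ),
    Matrix.mul_assoc (Matrix.map _ _) (Matrix.diagonal _) (Matrix.diagonal _),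
    Matrix.diagonal_mul_diagonal, ← Matrix.smul_mul, ← Matrix.mul_smul, ← Matrix.diagonal_smul]
  congr 3
  ext1 i
  simp only [Pi.smul_apply, smul_eq_mul]
  rw [hu i, map_mul, map_pow, zpow_sub₀ hX, zpow_natCast, zpow_natCast]
  ring

/-- If a matrix lies in the Cartan cells of two non-increasing tuples `μ` and `ν`, then `μ ≤ ν`:
otherwise a transition matrix in `GL_n(k⟦t⟧)` would be singular modulo `t`. -/
theorem InCartanCell.le {A : Matrix (Fin n) (Fin n) k⸨X⸩} {μ ν : Fin n → ℤ}
    (hμ : Antitone μ) (hν : Antitone ν) (h : InCartanCell A μ) (h' : InCartanCell A ν) :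
    μ ≤ ν := by
  obtain ⟨U, V, rfl⟩ := h
  obtain ⟨U', V', h⟩ := h'
  set φ := algebraMap k⟦X⟧ k⸨X⸩
  have hX : φ X ≠ 0 := algebraMap_X_ne_zero
  intro p
  by_contra! hp
  let W : GL (Fin n) k⟦X⟧ := V * V'⁻¹
  let W' : GL (Fin n) k⟦X⟧ := U⁻¹ * U'
  have hmap {G H : GL (Fin n) k⟦X⟧} :
      ((G * H : GL (Fin n) k⟦X⟧) : Matrix (Fin n) (Fin n) k⟦X⟧).map φ =
      (G : Matrix (Fin n) (Fin n) k⟦X⟧).map φ * (H : Matrix (Fin n) (Fin n) k⟦X⟧).map φ := by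
    rw [Units.val_mul, Matrix.map_mul]
  have hone : ((1 : GL (Fin n) k⟦X⟧) : Matrix (Fin n) (Fin n) k⟦X⟧).map φ = 1 :=
    Matrix.map_one φ (map_zero φ) (map_one φ)
  have hWW' : Matrix.diagonal (fun i ↦ φ X ^ μ i) * (W : Matrix (Fin n) (Fin n) k⟦X⟧).map φ =
      (W' : Matrix (Fin n) (Fin n) k⟦X⟧).map φ * Matrix.diagonal (fun i ↦ φ X ^ ν i) := by
    have h₁ := congrArg (fun M ↦
      ((U⁻¹ : GL (Fin n) k⟦X⟧) : Matrix (Fin n) (Fin n) k⟦X⟧).map φ * M *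
      ((V'⁻¹ : GL (Fin n) k⟦X⟧) : Matrix (Fin n) (Fin n) k⟦X⟧).map φ) h
    simp only [Matrix.mul_assoc, ← hmap, mul_inv_cancel, hone, Matrix.mul_one] at h₁
    simpa only [← Matrix.mul_assoc, ← hmap, inv_mul_cancel, hone, Matrix.one_mul] using h₁
  have hzero : ∀ i ≤ p, ∀ j ≥ p, constantCoeff ((W' : Matrix (Fin n) (Fin n) k⟦X⟧) i j) = 0 := by
    intro i hi j hj
    have hlt : ν j < μ i := (hν hj).trans_lt (hp.trans_le (hμ hi))
    have hij := congrFun (congrFun hWW' i) j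
    rw [Matrix.diagonal_mul, Matrix.mul_diagonal, Matrix.map_apply, Matrix.map_apply] at hij
    obtain ⟨m, hm⟩ := Int.eq_ofNat_of_zero_le (show 0 ≤ μ i - ν j - 1 by lia)
    have hμi : μ i = ((m + 1 : ℕ) : ℤ) + ν j := by push_cast; lia
    rw [hμi, zpow_add₀ hX, zpow_natCast, mul_right_comm, ← map_pow, ← map_mul] at hij
    rw [← IsFractionRing.injective k⟦X⟧ k⸨X⸩ (mul_right_cancel₀ (zpow_ne_zero _ hX) hij)]
    simp [pow_succ]
  have hdet : IsUnit (constantCoeff (W' : Matrix (Fin n) (Fin n) k⟦X⟧).det) :=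
    ((Matrix.isUnit_iff_isUnit_det _).1 W'.isUnit).map _
  rw [RingHom.map_det, RingHom.mapMatrix_apply] at hdet
  exact hdet.ne_zero (Matrix.det_eq_zero_of_forall_le_of_forall_ge _ p hzero)

end Cartan

/-- Cartan decomposition for `GL_n` over `k((t))`.  Let `k` be an
algebraically closed field and `n ≥ 1`.  Every `A ∈ GL_n(k((t)))` can be written as
`A = U · diag(t^{μ₁}, …, t^{μₙ}) · V` with `U, V ∈ GL_n(k⟦t⟧)` and `μ₁ ≥ ⋯ ≥ μₙ` integers,
and the non-increasing tuple `μ` is uniquely determined by `A`. -/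
theorem stmt11 (k : Type*) [Field k] [IsAlgClosed k] (n : ℕ) (hn : 1 ≤ n)
    (A : Matrix.GeneralLinearGroup (Fin n) (LaurentSeries k)) :
    ∃! μ : Fin n → ℤ, Antitone μ ∧
      ∃ U V : Matrix.GeneralLinearGroup (Fin n) (PowerSeries k),
        (A : Matrix (Fin n) (Fin n) (LaurentSeries k)) =
          ((U : Matrix (Fin n) (Fin n) (PowerSeries k)).map
              (algebraMap (PowerSeries k) (LaurentSeries k))) *
            Matrix.diagonal
              (fun i => (algebraMap (PowerSeries k) (LaurentSeries k) PowerSeries.X) ^ μ i) *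
          ((V : Matrix (Fin n) (Fin n) (PowerSeries k)).map
              (algebraMap (PowerSeries k) (LaurentSeries k))) := by
  obtain ⟨μ, hμ⟩ := exists_inCartanCell A
  have hsort : Antitone (μ ∘ Tuple.sort μ ∘ Fin.revPerm) :=
    fun i j hij ↦ Tuple.monotone_sort μ (Fin.rev_le_rev.2 hij)
  have hcell := hμ.comp_perm (Fin.revPerm.trans (Tuple.sort μ))
  refine ⟨_, ⟨hsort, hcell⟩, fun ν ⟨hν, hν'⟩ ↦ ?_⟩
  exact le_antisymm (InCartanCell.le hν hsort hν' hcell) (InCartanCell.le hsort hν hcell hν')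
end

section
/- Let k be an algebraically closed field, n ≥ 1, and let K = k((t)) be the field of formal Laurent series over k. Then for every invertible n×n matrix A ∈ GL_n(K) there exist: a matrix U ∈ GL_n(k[t⁻¹]), i.e. an n×n matrix whose entries are polynomials in t⁻¹ (Laurent series supported in non-positive degrees with finite support) and whose determinant is a unit of the subring k[t⁻¹] of K; a matrix V ∈ GL_n(k⟦t⟧); and a non-increasing sequence of integers μ₁ ≥ μ₂ ≥ ⋯ ≥ μₙ, such that A = U · diag(t^{μ₁}, …, t^{μₙ}) · V. Moreover, the sequence (μ₁, …, μₙ) is uniquely determined by A. In other words, GL_n(k((t))) is the disjoint union over non-increasing integer tuples μ of the double cosets GL_n(k[t⁻¹]) · t^μ · GL_n(k⟦t⟧). -/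
/-- The embedding `k[s] → k((t))` sending `s` to `t⁻¹`. -/
noncomputable abbrev polyInv (k : Type*) [Field k] : Polynomial k →ₐ[k] LaurentSeries k :=
  Polynomial.aeval ((algebraMap (PowerSeries k) (LaurentSeries k) PowerSeries.X)⁻¹)

/-- The matrix `diag(t^{μ₁}, …, t^{μₙ})` over `k((t))`. -/
noncomputable abbrev diagPow (k : Type*) [Field k] {n : ℕ} (μ : Fin n → ℤ) :
    Matrix (Fin n) (Fin n) (LaurentSeries k) :=
  Matrix.diagonal (fun i => (algebraMap (PowerSeries k) (LaurentSeries k) PowerSeries.X) ^ μ i)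

section Birkhoff

variable {k : Type*} [Field k] {n : ℕ}

local notation "ι" => algebraMap (PowerSeries k) (LaurentSeries k)
local notation "T" => algebraMap (PowerSeries k) (LaurentSeries k) PowerSeries.X

theorem algebraMap_X_ne_zero_s12 : T ≠ 0 := by
  simp

theorem algebraMap_powerSeries_C (c : k) :
    ι (PowerSeries.C c) = algebraMap k (LaurentSeries k) c := by
  rw [LaurentSeries.coe_algebraMap, HahnSeries.ofPowerSeries_C, LaurentSeries.algebraMap_apply]

theorem algebraMap_coe_polynomial (p : Polynomial k) :
    ι (p : PowerSeries k) = Polynomial.aeval T p := by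
  induction p using Polynomial.induction_on' with
  | add p q hp hq => rw [Polynomial.coe_add, map_add, map_add, hp, hq]
  | monomial m c =>
    rw [Polynomial.coe_monomial, Polynomial.aeval_monomial, ← algebraMap_powerSeries_C,
      PowerSeries.monomial_eq_mk, ← map_pow, ← map_mul]
    congr 1
    ext j
    simp [PowerSeries.coeff_X_pow]

/-- A nonzero polynomial in `t⁻¹` has non-positive order. -/
theorem nonneg_of_polyInv_mul_zpow_eq {p : Polynomial k} (hp : p ≠ 0) {a : ℤ}
    {f : PowerSeries k} (h : polyInv k p * T ^ a = ι f) : 0 ≤ a := by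
  by_contra! ha
  obtain ⟨b, rfl⟩ : ∃ b : ℕ, a = -((b : ℤ) + 1) := ⟨(-a - 1).toNat, by omega⟩
  have hT : T ≠ 0 := algebraMap_X_ne_zero_s12
  let _ : Invertible (T⁻¹) := invertibleOfNonzero (inv_ne_zero hT)
  have hrev := Polynomial.eval₂_reverse_mul_pow (algebraMap k (LaurentSeries k)) T⁻¹ p
  rw [← Polynomial.aeval_def, ← Polynomial.aeval_def, invOf_eq_inv, inv_inv,
    ← algebraMap_coe_polynomial] at hrev
  change _ = polyInv k p at hrev
  have key : (p.reverse : PowerSeries k) =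
      f * PowerSeries.X ^ (b + 1 + p.natDegree) := by
    apply IsFractionRing.injective (PowerSeries k) (LaurentSeries k)
    rw [map_mul, ← h, ← hrev, map_pow]
    have e : T ^ (-((b : ℤ) + 1)) = (T ^ (b + 1))⁻¹ := by
      rw [zpow_neg]; norm_cast
    rw [e, inv_pow]
    field_simp
    ring
  have h0 := congrArg PowerSeries.constantCoeff key
  rw [← PowerSeries.coeff_zero_eq_constantCoeff_apply, Polynomial.coeff_coe,
    Polynomial.coeff_zero_reverse] at h0
  simp at h0
  exact hp h0

/-- An antitone tuple dominating a rearrangement of an antitone tuple dominates it. -/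
theorem le_of_antitone_of_perm {μ ν : Fin n → ℤ} (hμ : Antitone μ) (hν : Antitone ν)
    (σ : Equiv.Perm (Fin n)) (h : ∀ i, ν (σ i) ≤ μ i) : ν ≤ μ := by
  intro p
  obtain ⟨i, hpi, hip⟩ : ∃ i, p ≤ i ∧ σ i ≤ p := by
    by_contra! hcon
    have hsub : (Finset.Ici p).map σ.toEmbedding ⊆ Finset.Ioi p := by
      intro x hx
      simp only [Finset.mem_map_equiv, Finset.mem_Ici] at hx
      simpa using hcon _ hx
    have hcard := Finset.card_le_card hsub
    rw [Finset.card_map, Fin.card_Ici, Fin.card_Ioi] at hcard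
    omega
  exact (hν hip).trans ((h i).trans (hμ hpi))

theorem diagPow_mul_neg (μ : Fin n → ℤ) : diagPow k (-μ) * diagPow k μ = 1 := by
  have hT : T ≠ 0 := algebraMap_X_ne_zero_s12
  rw [Matrix.diagonal_mul_diagonal, ← Matrix.diagonal_one]
  congr 1
  ext1 i
  rw [← zpow_add₀ hT]
  simp

theorem le_of_birkhoff_eq {μ ν : Fin n → ℤ} (hμ : Antitone μ) (hν : Antitone ν)
    {U U' : Matrix.GeneralLinearGroup (Fin n) (Polynomial k)}
    {V V' : Matrix.GeneralLinearGroup (Fin n) (PowerSeries k)}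
    (h : U.val.map (polyInv k) * diagPow k μ * V.val.map ι =
      U'.val.map (polyInv k) * diagPow k ν * V'.val.map ι) : ν ≤ μ := by
  have hT : T ≠ 0 := algebraMap_X_ne_zero_s12
  have hU : (U'⁻¹).val.map (polyInv k) * U'.val.map (polyInv k) = 1 := by
    rw [← Matrix.map_mul, Units.inv_mul]; simp
  have hV : V.val.map ι * (V⁻¹).val.map ι = 1 := by
    rw [← Matrix.map_mul, Units.mul_inv]; simp
  have key : diagPow k (-ν) * (U'⁻¹ * U).val.map (polyInv k) * diagPow k μ =
      (V' * V⁻¹).val.map ι := by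
    calc
      _ = diagPow k (-ν) * (U'⁻¹).val.map (polyInv k) *
          (U.val.map (polyInv k) * diagPow k μ * V.val.map ι) * (V⁻¹).val.map ι := by
        simp only [Units.val_mul, Matrix.map_mul, Matrix.mul_assoc, hV, Matrix.mul_one]
      _ = diagPow k (-ν) * ((U'⁻¹).val.map (polyInv k) * U'.val.map (polyInv k)) *
          diagPow k ν * (V'.val.map ι * (V⁻¹).val.map ι) := by
        rw [h]; simp only [Matrix.mul_assoc]
      _ = _ := by
        rw [hU, Matrix.mul_one, diagPow_mul_neg, Matrix.one_mul, Units.val_mul, Matrix.map_mul]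
  have hdet : (U'⁻¹ * U).val.det ≠ 0 :=
    ((Matrix.isUnit_iff_isUnit_det _).1 (U'⁻¹ * U).isUnit).ne_zero
  rw [Matrix.det_apply] at hdet
  obtain ⟨σ, -, hσ⟩ := Finset.exists_ne_zero_of_sum_ne_zero hdet
  have hprod : ∏ i, (U'⁻¹ * U).val (σ i) i ≠ 0 := fun h0 => hσ (by rw [h0, smul_zero])
  refine le_of_antitone_of_perm hμ hν σ fun i => ?_
  have hne := Finset.prod_ne_zero_iff.1 hprod i (Finset.mem_univ i)
  have hent := congrFun (congrFun key (σ i)) i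
  rw [Matrix.mul_diagonal, Matrix.diagonal_mul, Matrix.map_apply, Matrix.map_apply,
    mul_comm (T ^ _), mul_assoc, ← zpow_add₀ hT] at hent
  have := nonneg_of_polyInv_mul_zpow_eq hne hent
  simp only [Pi.neg_apply] at this
  omega

/-- One reduction step: if `W(0)` is singular, a row operation over `k[t⁻¹]` on `t^m W`
lets one more factor `t` be extracted. -/
theorem exists_reduction (m : Fin n → ℤ) (W : Matrix (Fin n) (Fin n) (PowerSeries k))
    (hW : ¬ IsUnit W.det) :
    ∃ (E : Matrix.GeneralLinearGroup (Fin n) (Polynomial k)) (m' : Fin n → ℤ)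
      (W' : Matrix (Fin n) (Fin n) (PowerSeries k)),
      E.val.map (polyInv k) * diagPow k m * W.map ι = diagPow k m' * W'.map ι ∧
      Associated (PowerSeries.X * W'.det) W.det := by
  classical
  have hT : T ≠ 0 := algebraMap_X_ne_zero_s12
  have hdet0 : (W.map (PowerSeries.constantCoeff (R := k))).det = 0 := by
    rw [PowerSeries.isUnit_iff_constantCoeff, isUnit_iff_ne_zero, not_not] at hW
    rw [← hW, RingHom.map_det]; rfl
  obtain ⟨c, hc0, hc⟩ := Matrix.exists_vecMul_eq_zero_iff.2 hdet0
  obtain ⟨i, hi, hmin⟩ := Finset.exists_min_image (Finset.univ.filter fun j => c j ≠ 0) m (by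
    obtain ⟨j, hj⟩ := Function.ne_iff.1 hc0
    exact ⟨j, by simpa using hj⟩)
  simp only [Finset.mem_filter, Finset.mem_univ, true_and] at hi hmin
  have hdiv : ∀ b, PowerSeries.X ∣ ∑ j, PowerSeries.C (c j) * W j b := by
    intro b
    rw [PowerSeries.X_dvd_iff]
    simpa [Matrix.vecMul, dotProduct] using congrFun hc b
  choose g hg using hdiv
  have hCi : IsUnit (PowerSeries.C (c i)) := (isUnit_iff_ne_zero.2 hi).map _
  set v : Fin n → Polynomial k :=
    fun j => Polynomial.C (c j) * Polynomial.X ^ (m j - m i).toNat with hv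
  have hE : IsUnit ((1 : Matrix (Fin n) (Fin n) (Polynomial k)).updateRow i v) := by
    rw [Matrix.isUnit_iff_isUnit_det, ← Matrix.cramer_transpose_apply, Matrix.transpose_one,
      Matrix.cramer_one]
    simpa [hv] using hi
  refine ⟨hE.unit, Function.update m i (m i + 1), W.updateRow i g, ?_, ?_⟩
  · rw [IsUnit.unit_spec, Matrix.mul_assoc]
    ext a b : 1
    rw [Matrix.diagonal_mul, Matrix.mul_apply]
    simp only [Matrix.diagonal_mul, Matrix.map_apply]
    by_cases ha : a = i
    · subst ha
      simp only [Matrix.updateRow_self, Function.update_self]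
      rw [zpow_add_one₀ hT, mul_assoc, ← map_mul, ← hg, map_sum, Finset.mul_sum]
      refine Finset.sum_congr rfl fun j _ => ?_
      by_cases hj : c j = 0
      · simp [hv, hj]
      have hle := hmin j hj
      have e : T ^ m j = T ^ (m j - m a).toNat * T ^ m a := by
        rw [← zpow_natCast, ← zpow_add₀ hT]
        congr 1
        omega
      rw [e, map_mul ι, algebraMap_powerSeries_C]
      simp only [hv, map_mul, Polynomial.aeval_C, map_pow, Polynomial.aeval_X, inv_pow]
      field_simp
    · simp only [Matrix.updateRow_ne ha, Function.update_of_ne ha]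
      rw [Finset.sum_eq_single a]
      · simp
      · intro j _ hj
        simp [Matrix.one_apply_ne' hj]
      · simp
  · rw [← Matrix.det_updateRow_smul]
    have e : (PowerSeries.X : PowerSeries k) • g = ∑ j, PowerSeries.C (c j) • W j := by
      ext1 b
      simp [← hg b]
    rw [e, Matrix.det_updateRow_sum, smul_eq_mul]
    exact (associated_isUnit_mul_left_iff hCi).2 (Associated.refl _)

theorem exists_birkhoff_of_dvd_X_pow (N : ℕ) (m : Fin n → ℤ)
    (W : Matrix (Fin n) (Fin n) (PowerSeries k)) (hW : W.det ∣ PowerSeries.X ^ N) :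
    ∃ (μ : Fin n → ℤ) (U : Matrix.GeneralLinearGroup (Fin n) (Polynomial k))
      (V : Matrix.GeneralLinearGroup (Fin n) (PowerSeries k)),
      diagPow k m * W.map ι = U.val.map (polyInv k) * diagPow k μ * V.val.map ι := by
  induction N generalizing m W with
  | zero =>
    have hu : IsUnit W := (Matrix.isUnit_iff_isUnit_det _).2 (isUnit_of_dvd_one (by simpa using hW))
    exact ⟨m, 1, hu.unit, by simp⟩
  | succ N ih =>
    by_cases hu : IsUnit W.det
    · have hu' : IsUnit W := (Matrix.isUnit_iff_isUnit_det _).2 hu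
      exact ⟨m, 1, hu'.unit, by simp⟩
    obtain ⟨E, m', W', hE, hassoc⟩ := exists_reduction m W hu
    have hdvd : W'.det ∣ PowerSeries.X ^ N := by
      have := hassoc.dvd.trans hW
      rw [pow_succ'] at this
      exact (mul_dvd_mul_iff_left PowerSeries.X_ne_zero).1 this
    obtain ⟨μ, U, V, h⟩ := ih m' W' hdvd
    have hEinv : (E⁻¹).val.map (polyInv k) * E.val.map (polyInv k) = 1 := by
      rw [← Matrix.map_mul, Units.inv_mul]; simp
    refine ⟨μ, E⁻¹ * U, V, ?_⟩
    rw [Units.val_mul, Matrix.map_mul, Matrix.mul_assoc, Matrix.mul_assoc,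
      ← Matrix.mul_assoc (U.val.map _), ← h, ← hE, ← Matrix.mul_assoc, ← Matrix.mul_assoc,
      hEinv, Matrix.one_mul]

theorem exists_birkhoff (A : Matrix.GeneralLinearGroup (Fin n) (LaurentSeries k)) :
    ∃ (μ : Fin n → ℤ) (U : Matrix.GeneralLinearGroup (Fin n) (Polynomial k))
      (V : Matrix.GeneralLinearGroup (Fin n) (PowerSeries k)),
      A.val = U.val.map (polyInv k) * diagPow k μ * V.val.map ι := by
  have hT : T ≠ 0 := algebraMap_X_ne_zero_s12
  obtain ⟨⟨_, M, rfl⟩, hb⟩ := IsLocalization.exist_integer_multiples_of_finite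
    (Submonoid.powers (PowerSeries.X : PowerSeries k)) (fun p : Fin n × Fin n => A.val p.1 p.2)
  choose w hw using hb
  set W : Matrix (Fin n) (Fin n) (PowerSeries k) := Matrix.of fun i j => w (i, j) with hWdef
  have hW : W.map ι = T ^ M • A.val := by
    ext i j : 1
    rw [hWdef, Matrix.map_apply, Matrix.of_apply, hw, Algebra.smul_def, map_pow, Matrix.smul_apply,
      smul_eq_mul]
  have hA : A.val = diagPow k (fun _ => -(M : ℤ)) * W.map ι := by
    ext i j : 1
    rw [Matrix.diagonal_mul, hW, Matrix.smul_apply, smul_eq_mul, zpow_neg, zpow_natCast,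
      inv_mul_cancel_left₀ (pow_ne_zero M hT)]
  have hdet : W.det ≠ 0 := by
    intro h0
    have h1 : (W.map ι).det = 0 := by
      rw [← RingHom.mapMatrix_apply, ← RingHom.map_det, h0, map_zero]
    rw [hW, Matrix.det_smul] at h1
    exact mul_ne_zero (pow_ne_zero _ (pow_ne_zero _ hT))
      ((Matrix.isUnit_iff_isUnit_det _).1 A.isUnit).ne_zero h1
  obtain ⟨N, hN⟩ := IsDiscreteValuationRing.associated_pow_irreducible hdet
    PowerSeries.X_irreducible
  rw [hA]
  exact exists_birkhoff_of_dvd_X_pow N _ W hN.dvd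

theorem exists_birkhoff_antitone (A : Matrix.GeneralLinearGroup (Fin n) (LaurentSeries k)) :
    ∃ μ : Fin n → ℤ, Antitone μ ∧
      ∃ (U : Matrix.GeneralLinearGroup (Fin n) (Polynomial k))
        (V : Matrix.GeneralLinearGroup (Fin n) (PowerSeries k)),
        A.val = U.val.map (polyInv k) * diagPow k μ * V.val.map ι := by
  obtain ⟨μ, U, V, h⟩ := exists_birkhoff A
  set σ := Tuple.sort (OrderDual.toDual ∘ μ)
  have hσ : Antitone (μ ∘ σ) := fun i j hij => Tuple.monotone_sort (OrderDual.toDual ∘ μ) hij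
  have hU : IsUnit (U.val.submatrix id σ) := by
    rw [Matrix.isUnit_iff_isUnit_det, Matrix.det_permute']
    exact ((Equiv.Perm.sign σ).isUnit.map (Int.castRingHom _)).mul
      ((Matrix.isUnit_iff_isUnit_det _).1 U.isUnit)
  have hV : IsUnit (V.val.submatrix σ id) := by
    rw [Matrix.isUnit_iff_isUnit_det, Matrix.det_permute]
    exact ((Equiv.Perm.sign σ).isUnit.map (Int.castRingHom _)).mul
      ((Matrix.isUnit_iff_isUnit_det _).1 V.isUnit)
  refine ⟨μ ∘ σ, hσ, hU.unit, hV.unit, ?_⟩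
  have hD : diagPow k (μ ∘ σ) = (diagPow k μ).submatrix σ σ := by
    rw [Matrix.submatrix_diagonal_equiv]; rfl
  rw [h, IsUnit.unit_spec, IsUnit.unit_spec, hD, ← Matrix.submatrix_map, ← Matrix.submatrix_map,
    Matrix.submatrix_mul_equiv, Matrix.submatrix_mul_equiv, Matrix.submatrix_id_id]

end Birkhoff

/-- Birkhoff decomposition for `GL_n` over `k((t))`.  Let `k` be an
algebraically closed field and `n ≥ 1`.  Every `A ∈ GL_n(k((t)))` can be written as
`A = U · diag(t^{μ₁}, …, t^{μₙ}) · V` with `U ∈ GL_n(k[t⁻¹])` (the subring `k[t⁻¹]` of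
`k((t))` being realized as the image of the polynomial ring `k[X]` under `X ↦ t⁻¹`),
`V ∈ GL_n(k⟦t⟧)`, and `μ₁ ≥ ⋯ ≥ μₙ` integers; the non-increasing tuple `μ` is uniquely
determined by `A`. -/
theorem stmt12 (k : Type*) [Field k] [IsAlgClosed k] (n : ℕ) (hn : 1 ≤ n)
    (A : Matrix.GeneralLinearGroup (Fin n) (LaurentSeries k)) :
    ∃! μ : Fin n → ℤ, Antitone μ ∧
      ∃ (U : Matrix.GeneralLinearGroup (Fin n) (Polynomial k))
        (V : Matrix.GeneralLinearGroup (Fin n) (PowerSeries k)),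
        (A : Matrix (Fin n) (Fin n) (LaurentSeries k)) =
          ((U : Matrix (Fin n) (Fin n) (Polynomial k)).map
              (Polynomial.aeval
                ((algebraMap (PowerSeries k) (LaurentSeries k) PowerSeries.X)⁻¹) :
                Polynomial k →ₐ[k] LaurentSeries k)) *
            Matrix.diagonal
              (fun i => (algebraMap (PowerSeries k) (LaurentSeries k) PowerSeries.X) ^ μ i) *
          ((V : Matrix (Fin n) (Fin n) (PowerSeries k)).map
              (algebraMap (PowerSeries k) (LaurentSeries k))) := by
  obtain ⟨μ, hμ, U, V, h⟩ := exists_birkhoff_antitone A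
  refine ⟨μ, ⟨hμ, U, V, h⟩, ?_⟩
  rintro ν ⟨hν, U', V', h'⟩
  exact le_antisymm (le_of_birkhoff_eq hμ hν (h.symm.trans h'))
    (le_of_birkhoff_eq hν hμ (h'.symm.trans h))
end
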